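/- Let M ⪯ N be models of a complete first-order L-theory such that M (equivalently, its theory) is distal (in particular NIP). Let φ(x,y) be an L-formula with parameters from M and let b be a tuple from N of the appropriate sort. Assume that φ(x,b) does not divide over M. Then there is an L-formula ψ(y) with parameters from M such that N ⊨ ψ(b) and the family of formulas {φ(x,b′) : b′ a tuple from M with M ⊨ ψ(b′)} is consistent (i.e., finitely satisfiable in a sufficiently saturated elementary extension). -/

import Mathlib

open FirstOrder FirstOrder.Language

universe u v w

namespace DistalPaper

variable (L : FirstOrder.Language.{u, v})

def SameTypeOver {N : Type w} [L.Structure N] (A : Set N) {γ : Type*} (b b' : γ → N) : Prop :=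
  ∀ (p : ℕ) (φ : L.Formula (γ ⊕ Fin p)) (m : Fin p → N), (∀ i, m i ∈ A) →
    (φ.Realize (Sum.elim b m) ↔ φ.Realize (Sum.elim b' m))

def IsIndiscernibleOver {N : Type w} [L.Structure N] (A : Set N) {I : Type*} [LinearOrder I]
    {γ : Type*} (b : I → γ → N) : Prop :=
  ∀ (m : ℕ) (i j : Fin m → I), StrictMono i → StrictMono j →
    SameTypeOver L A (fun q : Fin m × γ => b (i q.1) q.2) (fun q : Fin m × γ => b (j q.1) q.2)

def IsConsistentFamily {N : Type w} [L.Structure N] {α γ ι : Type*}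
    (φ : L.Formula (α ⊕ γ)) (b : ι → γ → N) : Prop :=
  ∀ s : Finset ι, ∃ a : α → N, ∀ i ∈ s, φ.Realize (Sum.elim a (b i))

structure ElemExt (N : Type w) [L.Structure N] where
  Carrier : Type max u v w
  [str : L.Structure Carrier]
  emb : N ↪ₑ[L] Carrier

attribute [instance] ElemExt.str

def Divides {N : Type w} [L.Structure N] (A : Set N) {α γ : Type*}
    (φ : L.Formula (α ⊕ γ)) (b : γ → N) : Prop :=
  ∃ (E : ElemExt L N) (c : ℕ → γ → E.Carrier),
    IsIndiscernibleOver L (⇑E.emb '' A) c ∧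
    SameTypeOver L (⇑E.emb '' A) (c 0) (⇑E.emb ∘ b) ∧
    ¬ IsConsistentFamily L φ c

/-- The formula `φ(x, b)` forks over `A`: in some elementary extension it implies a finite
disjunction of formulas, each of which divides over (the image of) `A`. -/
def Forks {N : Type w} [L.Structure N] (A : Set N) {α γ : Type*}
    (φ : L.Formula (α ⊕ γ)) (b : γ → N) : Prop :=
  ∃ (E : ElemExt L N) (k m : ℕ) (ψ : Fin k → L.Formula (α ⊕ Fin m))
    (c : Fin k → Fin m → E.Carrier),
    (∀ i, Divides L (⇑E.emb '' A) (ψ i) (c i)) ∧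
    ∀ a : α → E.Carrier, φ.Realize (Sum.elim a (⇑E.emb ∘ b)) →
      ∃ i, (ψ i).Realize (Sum.elim a (c i))

/-- The complete type of the tuple `bs` over the parameter set `P` does not fork over `A`:
no formula with parameters from `P` satisfied by `bs` forks over `A`. -/
def TypeDoesNotForkOver {N : Type w} [L.Structure N] (A P : Set N) {β : Type*}
    (bs : β → N) : Prop :=
  ∀ (p : ℕ) (φ : L.Formula (β ⊕ Fin p)) (c : Fin p → N), (∀ i, c i ∈ P) →
    φ.Realize (Sum.elim bs c) → ¬ Forks L A φ c

/-- `tp(a / A ∪ bs)` is strictly non-forking over `A`: it extends to a complete type `p`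
over a monster model (an elementary extension `E` of `N`, realized by `a'` in a further
elementary extension `F`) such that `p` does not fork over `A` and, for the realization
`a'` of `p`, `tp(bs / A a')` does not fork over `A`. -/
def StrictlyNonForkingOver {N : Type w} [L.Structure N] (A : Set N) {α β : Type*}
    (a : α → N) (bs : β → N) : Prop :=
  ∃ (E : ElemExt L N) (F : ElemExt L E.Carrier) (a' : α → F.Carrier),
    SameTypeOver L ((⇑F.emb ∘ ⇑E.emb) '' (A ∪ Set.range bs)) a' (⇑F.emb ∘ ⇑E.emb ∘ a) ∧
    TypeDoesNotForkOver L ((⇑F.emb ∘ ⇑E.emb) '' A) (Set.range ⇑F.emb) a' ∧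
    TypeDoesNotForkOver L ((⇑F.emb ∘ ⇑E.emb) '' A)
      (((⇑F.emb ∘ ⇑E.emb) '' A) ∪ Set.range a') (⇑F.emb ∘ ⇑E.emb ∘ bs)

/-- `b` is a strict Morley sequence over `A` for the complete type (over `A`) of the
tuple `q`: an `A`-indiscernible sequence of realizations of `tp(q/A)` such that each
`tp(b (n+1) / A, b 0, ..., b n)` is strictly non-forking over `A`. -/
def IsStrictMorleySequence {N : Type w} [L.Structure N] (A : Set N) {γ : Type*}
    (q : γ → N) (b : ℕ → γ → N) : Prop :=
  IsIndiscernibleOver L A b ∧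
  (∀ n, SameTypeOver L A (b n) q) ∧
  ∀ n : ℕ, StrictlyNonForkingOver L A (b (n + 1)) (fun p : Fin (n + 1) × γ => b ↑p.1 p.2)

/-- `N` (equivalently, its complete theory) is NIP: no formula `φ(x, y)` has the
independence property in any model of `Th(N)`. -/
def IsNIP (N : Type w) [L.Structure N] : Prop :=
  ∀ (nx ny : ℕ) (φ : L.Formula (Fin nx ⊕ Fin ny)),
    ¬ ∃ (K : Theory.ModelType.{u, v, max u v w} (L.completeTheory N))
        (a : ℕ → Fin nx → K) (bS : Set ℕ → Fin ny → K),
        ∀ (i : ℕ) (S : Set ℕ), φ.Realize (Sum.elim (a i) (bS S)) ↔ i ∈ S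

/-- `N` is distal: it is NIP and, in every elementary extension, for every indiscernible
sequence `(b i)_{i ∈ ℤ}` and parameter set `A`, if the sequence with `b 0` omitted is
indiscernible over `A`, then the whole sequence is indiscernible over `A`. -/
def IsDistal (N : Type w) [L.Structure N] : Prop :=
  IsNIP L N ∧
  ∀ (E : ElemExt L N) (m : ℕ) (b : ℤ → Fin m → E.Carrier) (A : Set E.Carrier),
    IsIndiscernibleOver L (∅ : Set E.Carrier) b →
    IsIndiscernibleOver L A (fun i : {i : ℤ // i ≠ 0} => b ↑i) →
    IsIndiscernibleOver L A b

/-- `N` is `κ`-saturated: every finitely satisfiable family of formulas in finitely many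
free variables with parameters from a set of size `< κ` is realized in `N`. -/
def IsSaturated (κ : Cardinal.{w}) (N : Type w) [L.Structure N] : Prop :=
  ∀ (A : Set N), Cardinal.mk A < κ →
    ∀ (n : ℕ) (ι : Type max u v w) (p : ι → ℕ) (φ : ∀ i, L.Formula (Fin n ⊕ Fin (p i)))
      (c : ∀ i, Fin (p i) → N), (∀ i j, c i j ∈ A) →
      (∀ s : Finset ι, ∃ a : Fin n → N, ∀ i ∈ s, (φ i).Realize (Sum.elim a (c i))) →
      ∃ a : Fin n → N, ∀ i, (φ i).Realize (Sum.elim a (c i))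

/-- The complete type of `a` over the parameter set `P` (with `A ⊆ P`) extends to a
complete type over all of `N` which is `A`-invariant; the extension is encoded by a
realization `a'` in an elementary extension of `N`. -/
def ExtendsToInvariantType {N : Type w} [L.Structure N] (A P : Set N) {α : Type*}
    (a : α → N) : Prop :=
  ∃ (E : ElemExt L N) (a' : α → E.Carrier),
    SameTypeOver L (⇑E.emb '' P) a' (⇑E.emb ∘ a) ∧
    ∀ (p : ℕ) (φ : L.Formula (α ⊕ Fin p)) (c c' : Fin p → N),
      SameTypeOver L A c c' →
      (φ.Realize (Sum.elim a' (⇑E.emb ∘ c)) ↔ φ.Realize (Sum.elim a' (⇑E.emb ∘ c')))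

/-- Two sequences have the same Ehrenfeucht–Mostowski type over `A`: increasing tuples
of the same length from either sequence have the same type over `A`. -/
def SameEMTypeOver {N : Type w} [L.Structure N] (A : Set N) {I J : Type*}
    [LinearOrder I] [LinearOrder J] {γ : Type*} (b : I → γ → N) (d : J → γ → N) : Prop :=
  ∀ (m : ℕ) (i : Fin m → I) (j : Fin m → J), StrictMono i → StrictMono j →
    SameTypeOver L A (fun q : Fin m × γ => b (i q.1) q.2) (fun q : Fin m × γ => d (j q.1) q.2)

/-- Insert the tuple `d` at position `0` into a sequence indexed by the nonzero integers. -/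
def insertAtZero {X γ : Type*} (d : γ → X) (ds : {i : ℤ // i ≠ 0} → γ → X) : ℤ → γ → X :=
  fun i => if h : i = 0 then d else ds ⟨i, h⟩


section
open Filter

/-- Abstract framework: a saturated structure `U`, a small model `M`, and the `M`-definable sets. -/
structure Sys (U : Type w) where
  M : Set U
  Def : ∀ {γ : Type}, Set (γ → U) → Prop
  univ : ∀ {γ : Type}, Def (Set.univ : Set (γ → U))
  compl : ∀ {γ : Type} {S : Set (γ → U)}, Def S → Def Sᶜ
  inter : ∀ {γ : Type} {S S' : Set (γ → U)}, Def S → Def S' → Def (S ∩ S')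
  pre : ∀ {γ δ : Type} (f : γ → δ) {S : Set (γ → U)}, Def S → Def {v : δ → U | v ∘ f ∈ S}
  proj : ∀ {α β : Type} [Finite α] {S : Set (α ⊕ β → U)}, Def S →
    Def {v : β → U | ∃ w : α → U, Sum.elim w v ∈ S}
  tv : ∀ {γ : Type} [Finite γ] {S : Set (γ → U)}, Def S → S.Nonempty → ∃ v ∈ S, ∀ i, v i ∈ M
  fiber : ∀ {α β : Type} [Finite α] {S : Set (α ⊕ β → U)}, Def S → ∀ m : α → U, (∀ i, m i ∈ M) →
    Def {v : β → U | Sum.elim m v ∈ S}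
  sat : ∀ {α β : Type} [Finite α] [Finite β] (h : β → U) (P : Set (Set (α ⊕ β → U))),
    (∀ S ∈ P, Def S) →
    (∀ t : Finset (Set (α ⊕ β → U)), (∀ S ∈ t, S ∈ P) → ∃ v : α → U, ∀ S ∈ t, Sum.elim v h ∈ S) →
    ∃ v : α → U, ∀ S ∈ P, Sum.elim v h ∈ S
  nip : ∀ {α β : Type} [Finite α] [Finite β] {S : Set (α ⊕ β → U)}, Def S →
    ∃ d : ℕ, ¬ ∃ (a : Fin d → α → U) (b : Set (Fin d) → β → U),
      ∀ i X, Sum.elim (a i) (b X) ∈ S ↔ i ∈ X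

namespace Sys
variable {U : Type w} (T : Sys U)

def eqv {γ : Type} (h h' : γ → U) : Prop := ∀ S : Set (γ → U), T.Def S → (h ∈ S ↔ h' ∈ S)

variable {T}

theorem mcong {X : Type*} {S : Set (X → U)} {v v' : X → U} (e : ∀ x, v x = v' x) :
    v ∈ S ↔ v' ∈ S := by rw [funext e]

theorem mcong' {X : Type*} {S : Set (X → U)} {v v' : X → U} (h : v ∈ S) (e : ∀ x, v' x = v x) :
    v' ∈ S := by rwa [funext e]

theorem eqv.refl {γ : Type} (h : γ → U) : T.eqv h h := fun _ _ => Iff.rfl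
theorem eqv.symm {γ : Type} {h h' : γ → U} (H : T.eqv h h') : T.eqv h' h :=
  fun S hS => (H S hS).symm
theorem eqv.trans {γ : Type} {h h' h'' : γ → U} (H : T.eqv h h') (H' : T.eqv h' h'') :
    T.eqv h h'' := fun S hS => (H S hS).trans (H' S hS)

theorem eqv.comp {γ δ : Type} {h h' : γ → U} (H : T.eqv h h') (f : δ → γ) :
    T.eqv (h ∘ f) (h' ∘ f) := fun _ hS => H _ (T.pre f hS)

theorem eqv.of {γ δ : Type} {h h' : γ → U} (H : T.eqv h h') (f : δ → γ) {g g' : δ → U}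
    (e : ∀ i, g i = h (f i)) (e' : ∀ i, g' i = h' (f i)) : T.eqv g g' := by
  have := H.comp f
  rwa [show g = h ∘ f from funext e, show g' = h' ∘ f from funext e']

theorem Def_union {γ : Type} {S S' : Set (γ → U)} (h : T.Def S) (h' : T.Def S') :
    T.Def (S ∪ S') := by
  have := T.compl (T.inter (T.compl h) (T.compl h'))
  rwa [Set.compl_inter, compl_compl, compl_compl] at this

theorem Def_empty {γ : Type} : T.Def (∅ : Set (γ → U)) := by
  have := T.compl (T.univ (γ := γ)); rwa [Set.compl_univ] at this

theorem Def_iInter {γ ι : Type} [Finite ι] {S : ι → Set (γ → U)} (h : ∀ i, T.Def (S i)) :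
    T.Def {v | ∀ i, v ∈ S i} := by
  have key : ∀ s : Set ι, s.Finite → T.Def {v | ∀ i ∈ s, v ∈ S i} := by
    intro s hs
    induction s, hs using Set.Finite.induction_on with
    | empty => simpa using T.univ
    | @insert a _ _ _ ih =>
      have := T.inter (h a) ih
      convert this using 1
      ext v; simp
  simpa using key Set.univ Set.finite_univ

theorem Def_iUnion {γ ι : Type} [Finite ι] {S : ι → Set (γ → U)} (h : ∀ i, T.Def (S i)) :
    T.Def {v | ∃ i, v ∈ S i} := by
  have := T.compl (Def_iInter fun i => T.compl (h i))
  convert this using 1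
  ext v; simp

theorem Def_forall {α β : Type} [Finite α] {S : Set (α ⊕ β → U)} (h : T.Def S) :
    T.Def {v : β → U | ∀ w : α → U, Sum.elim w v ∈ S} := by
  have := T.compl (T.proj (T.compl h))
  convert this using 1
  ext v; simp

/-- preimage in convenient form -/
theorem Def_pre {γ δ : Type} {S : Set (γ → U)} (h : T.Def S) (f : γ → δ) {S' : Set (δ → U)}
    (e : ∀ v, v ∈ S' ↔ v ∘ f ∈ S) : T.Def S' := by
  have := T.pre f h
  rwa [show S' = {v : δ → U | v ∘ f ∈ S} from Set.ext e]

theorem sat_inter {α β : Type} [Finite α] [Finite β] (h : β → U) (P : Set (Set (α ⊕ β → U)))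
    (hD : ∀ S ∈ P, T.Def S) (hu : Set.univ ∈ P) (hi : ∀ S ∈ P, ∀ S' ∈ P, S ∩ S' ∈ P)
    (hne : ∀ S ∈ P, ∃ v : α → U, Sum.elim v h ∈ S) :
    ∃ v : α → U, ∀ S ∈ P, Sum.elim v h ∈ S := by
  classical
  refine T.sat h P hD fun t ht => ?_
  have : ∃ S ∈ P, ∀ S' ∈ t, S ⊆ S' := by
    induction t using Finset.induction_on with
    | empty => exact ⟨_, hu, by simp⟩
    | insert a s _ ih =>
      obtain ⟨S, hS, hS'⟩ := ih fun S hS => ht S (by simp [hS])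
      refine ⟨a ∩ S, hi _ (ht a (by simp)) _ hS, ?_⟩
      intro S' h'
      rcases Finset.mem_insert.1 h' with rfl | h'
      · exact Set.inter_subset_left
      · exact Set.inter_subset_right.trans (hS' _ h')
  obtain ⟨S, hS, hS'⟩ := this
  obtain ⟨v, hv⟩ := hne S hS
  exact ⟨v, fun S' h' => hS' S' h' hv⟩

theorem eqv.extend {α β : Type} [Finite α] [Finite β] {h h' : β → U} (H : T.eqv h h')
    (g : α → U) : ∃ g', T.eqv (Sum.elim g h) (Sum.elim g' h') := by
  obtain ⟨v, hv⟩ := sat_inter (T := T) h' {S : Set (α ⊕ β → U) | T.Def S ∧ Sum.elim g h ∈ S}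
    (fun S hS => hS.1) ⟨T.univ, trivial⟩
    (fun S hS S' hS' => ⟨T.inter hS.1 hS'.1, hS.2, hS'.2⟩)
    (fun S hS => (H _ (T.proj hS.1)).1 ⟨g, hS.2⟩)
  refine ⟨v, fun S hS => ⟨fun h1 => hv S ⟨hS, h1⟩, fun h1 => ?_⟩⟩
  by_contra h2
  exact hv _ ⟨T.compl hS, h2⟩ h1

theorem exists_ultra {X : Type*} (P : Set (Set X)) (hu : P.Nonempty)
    (hi : ∀ S ∈ P, ∀ S' ∈ P, ∃ S'' ∈ P, S'' ⊆ S ∩ S')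
    (hne : ∀ S ∈ P, S.Nonempty) : ∃ 𝒰 : Ultrafilter X, ∀ S ∈ P, S ∈ 𝒰 := by
  let F : FilterBasis X := ⟨P, hu, fun {x y} hx hy => hi x hx y hy⟩
  have : F.filter.NeBot := by
    rw [F.hasBasis.neBot_iff]
    intro S hS; exact hne S hS
  exact ⟨Ultrafilter.of F.filter, fun S hS => Ultrafilter.of_le _ (F.mem_filter_of_mem hS)⟩

variable (T)

/-- `M`-invariance of an ultrafilter -/
def Inv {γ : Type} (𝒰 : Ultrafilter (γ → U)) : Prop :=
  ∀ {β : Type} [Finite β] (S : Set (γ ⊕ β → U)), T.Def S → ∀ c c' : β → U, T.eqv c c' →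
    (∀ᶠ y in 𝒰, Sum.elim y c ∈ S) → (∀ᶠ y in 𝒰, Sum.elim y c' ∈ S)

/-- An abstract global `M`-invariant type. -/
structure InvType (γ : Type) where
  Rel : ∀ {β : Type}, (β → U) → (γ → U) → Prop
  ex : ∀ {β : Type} [Finite β] (h : β → U), ∃ D, Rel h D
  mono : ∀ {β β' : Type} (f : β' → β) {h : β → U} {D : γ → U}, Rel h D → Rel (h ∘ f) D
  inv : ∀ {β : Type} [Finite β] {h h' : β → U} {D D' : γ → U}, T.eqv h h' → Rel h D → Rel h' D' →
    T.eqv (Sum.elim D h) (Sum.elim D' h')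
  closure : ∀ {β : Type} [Finite β] {h h' : β → U} {D D' : γ → U}, Rel h D →
    T.eqv (Sum.elim D h) (Sum.elim D' h') → Rel h' D'

variable {T}

def uRel (T : Sys U) {γ β : Type} (𝒰 : Ultrafilter (γ → U)) (h : β → U) (g : γ → U) : Prop :=
  ∀ S : Set (γ ⊕ β → U), T.Def S → (Sum.elim g h ∈ S ↔ ∀ᶠ y in 𝒰, Sum.elim y h ∈ S)

theorem uRel_mem {γ β : Type} {𝒰 : Ultrafilter (γ → U)} {h : β → U} {g : γ → U}
    (H : ∀ S : Set (γ ⊕ β → U), T.Def S → (∀ᶠ y in 𝒰, Sum.elim y h ∈ S) → Sum.elim g h ∈ S) :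
    T.uRel 𝒰 h g := by
  refine fun S hS => ⟨fun h1 => ?_, H S hS⟩
  by_contra h2
  rw [← Ultrafilter.eventually_not] at h2
  exact H _ (T.compl hS) h2 h1

theorem uRel_ex {γ β : Type} [Finite γ] [Finite β] (𝒰 : Ultrafilter (γ → U)) (h : β → U) :
    ∃ g, T.uRel 𝒰 h g := by
  obtain ⟨v, hv⟩ := sat_inter (T := T) h
    {S : Set (γ ⊕ β → U) | T.Def S ∧ ∀ᶠ y in 𝒰, Sum.elim y h ∈ S}
    (fun S hS => hS.1) ⟨T.univ, Eventually.of_forall fun _ => trivial⟩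
    (fun S hS S' hS' => ⟨T.inter hS.1 hS'.1, hS.2.and hS'.2⟩)
    (fun S hS => hS.2.exists)
  exact ⟨v, uRel_mem fun S hS h1 => hv S ⟨hS, h1⟩⟩

/-- The invariant type of an invariant ultrafilter. -/
def ofUltra {γ : Type} [Finite γ] (𝒰 : Ultrafilter (γ → U)) (hI : T.Inv 𝒰) : T.InvType γ where
  Rel := fun h g => T.uRel 𝒰 h g
  ex := fun h => uRel_ex 𝒰 h
  mono := by
    intro β β' f h D H S hS
    have hS' : T.Def {v : γ ⊕ β → U | v ∘ Sum.map id f ∈ S} := T.pre _ hS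
    have := H _ hS'
    simpa [Sum.elim_comp_map] using this
  inv := by
    intro β _ h h' D D' e H H' S hS
    rw [H S hS, H' S hS]
    exact ⟨hI S hS _ _ e, hI S hS _ _ e.symm⟩
  closure := by
    intro β _ h h' D D' H e
    refine uRel_mem fun S hS h1 => ?_
    rw [← e S hS, H S hS]
    exact hI S hS _ _ (e.of Sum.inr (fun _ => rfl) (fun _ => rfl)).symm h1

/-- `M`-concentrated ultrafilters -/
def Conc (T : Sys U) {γ : Type} (𝒰 : Ultrafilter (γ → U)) : Prop :=
  ∀ᶠ y in (𝒰 : Filter (γ → U)), ∀ i, y i ∈ T.M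

theorem Conc.inv {γ : Type} [Finite γ] {𝒰 : Ultrafilter (γ → U)} (hC : T.Conc 𝒰) : T.Inv 𝒰 := by
  intro β _ S hS c c' e h
  filter_upwards [h, hC] with y hy hM
  exact (e _ (T.fiber hS y hM)).1 hy

/-- coheirs -/
theorem exists_conc {γ : Type} (P : Set (Set (γ → U))) (hu : P.Nonempty)
    (hi : ∀ S ∈ P, ∀ S' ∈ P, ∃ S'' ∈ P, S'' ⊆ S ∩ S')
    (hne : ∀ S ∈ P, ∃ v ∈ S, ∀ i, v i ∈ T.M) :
    ∃ 𝒰 : Ultrafilter (γ → U), T.Conc 𝒰 ∧ ∀ S ∈ P, S ∈ 𝒰 := by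
  obtain ⟨𝒰, h𝒰⟩ := exists_ultra ((fun S => S ∩ {v | ∀ i, v i ∈ T.M}) '' P) (hu.image _)
    (by
      rintro _ ⟨S, hS, rfl⟩ _ ⟨S', hS', rfl⟩
      obtain ⟨S'', h1, h2⟩ := hi S hS S' hS'
      refine ⟨_, ⟨S'', h1, rfl⟩, ?_⟩
      intro v hv
      exact ⟨⟨(h2 hv.1).1, hv.2⟩, ⟨(h2 hv.1).2, hv.2⟩⟩)
    (by
      rintro _ ⟨S, hS, rfl⟩
      obtain ⟨v, h1, h2⟩ := hne S hS
      exact ⟨v, h1, h2⟩)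
  obtain ⟨S0, hS0⟩ := hu
  refine ⟨𝒰, ?_, fun S hS => ?_⟩
  · exact mem_of_superset (h𝒰 _ ⟨S0, hS0, rfl⟩) Set.inter_subset_right
  · exact mem_of_superset (h𝒰 _ ⟨S, hS, rfl⟩) Set.inter_subset_left

theorem exists_coheir {γ : Type} [Finite γ] (c : γ → U) :
    ∃ 𝒰 : Ultrafilter (γ → U), T.Conc 𝒰 ∧ ∀ S, T.Def S → c ∈ S → S ∈ 𝒰 := by
  obtain ⟨𝒰, h, h'⟩ := exists_conc (T := T) {S | T.Def S ∧ c ∈ S} ⟨_, T.univ, trivial⟩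
    (fun S hS S' hS' => ⟨S ∩ S', ⟨T.inter hS.1 hS'.1, hS.2, hS'.2⟩, subset_rfl⟩)
    (fun S hS => T.tv hS.1 ⟨c, hS.2⟩)
  exact ⟨𝒰, h, fun S hS hc => h' S ⟨hS, hc⟩⟩

/-- realization over the empty tuple -/
theorem uRel_empty {γ : Type} {𝒰 : Ultrafilter (γ → U)} {c : γ → U} (h : Empty → U)
    (H : ∀ S, T.Def S → c ∈ S → S ∈ 𝒰) : T.uRel 𝒰 h c := by
  have key : ∀ S : Set (γ ⊕ Empty → U), T.Def S → Sum.elim c h ∈ S →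
      ∀ᶠ y in 𝒰, Sum.elim y h ∈ S := by
    intro S hS hc
    have hS' : T.Def {y : γ → U | Sum.elim y h ∈ S} := by
      refine Def_pre hS (Sum.elim id Empty.elim) ?_
      intro v
      have : Sum.elim v h = v ∘ Sum.elim id Empty.elim := by
        funext x; rcases x with x | x
        · rfl
        · exact x.elim
      rw [Set.mem_ofPred_eq, this]
    exact H _ hS' hc
  refine uRel_mem fun S hS h1 => ?_
  by_contra h2
  have h3 := key _ (T.compl hS) h2
  obtain ⟨y, h4, h5⟩ := (h1.and h3).exists
  exact h5 h4

namespace InvType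

theorem mono' {γ β β' : Type} (Q : T.InvType γ) {h : β → U} {D : γ → U} (H : Q.Rel h D)
    (f : β' → β) {g : β' → U} (e : ∀ i, g i = h (f i)) : Q.Rel g D := by
  have := Q.mono f H
  rwa [← show g = h ∘ f from funext e] at this

/-- tensor product -/
def tensor {γ γ' : Type} [Finite γ] [Finite γ'] (Q : T.InvType γ) (R : T.InvType γ') :
    T.InvType (γ' ⊕ γ) where
  Rel := fun h D => Q.Rel h (D ∘ Sum.inr) ∧ R.Rel (Sum.elim (D ∘ Sum.inr) h) (D ∘ Sum.inl)
  ex := by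
    intro β _ h
    obtain ⟨D, hD⟩ := Q.ex h
    obtain ⟨D', hD'⟩ := R.ex (Sum.elim D h)
    exact ⟨Sum.elim D' D, hD, hD'⟩
  mono := by
    intro β β' f h D H
    refine ⟨Q.mono f H.1, R.mono' H.2 (Sum.map id f) ?_⟩
    rintro (x | x) <;> rfl
  inv := by
    intro β _ h h' D D' e H H'
    have := R.inv (Q.inv e H.1 H'.1) H.2 H'.2
    refine this.of (Equiv.sumAssoc _ _ _) ?_ ?_ <;> rintro ((x | x) | x) <;> rfl
  closure := by
    intro β _ h h' D D' H e
    have e1 : T.eqv (Sum.elim (D ∘ Sum.inl) (Sum.elim (D ∘ Sum.inr) h))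
        (Sum.elim (D' ∘ Sum.inl) (Sum.elim (D' ∘ Sum.inr) h')) := by
      refine e.of (Equiv.sumAssoc _ _ _).symm ?_ ?_ <;> rintro (x | (x | x)) <;> rfl
    exact ⟨Q.closure H.1 (e1.of Sum.inr (fun _ => rfl) (fun _ => rfl)), R.closure H.2 e1⟩

end InvType

def initSeg {ζ : Type} (g : ℕ → ζ → U) (j : ℕ) : Fin j × ζ → U := fun p => g p.1 p.2

/-- `g 0, …, g (k-1)` is a Morley sequence of `Q` over `h` -/
def Morley {ζ β : Type} (Q : T.InvType ζ) (h : β → U) (g : ℕ → ζ → U) (k : ℕ) : Prop :=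
  ∀ j < k, Q.Rel (Sum.elim (initSeg g j) h) (g j)

theorem Morley.le {ζ β : Type} {Q : T.InvType ζ} {h : β → U} {g : ℕ → ζ → U} {k k' : ℕ}
    (H : Morley Q h g k) (hk : k' ≤ k) : Morley Q h g k' := fun j hj => H j (hj.trans_le hk)

theorem Morley.sub {ζ β β' : Type} {Q : T.InvType ζ} {h : β → U} {g : ℕ → ζ → U} {k k' : ℕ}
    (H : Morley Q h g k) (σ : ℕ → ℕ) (hσ : ∀ j < k', σ j < k)
    (hm : ∀ i j, i < j → j < k' → σ i < σ j) {h' : β' → U}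
    (hh : ∀ j < k', ∃ f : β' → (Fin (σ j) × ζ) ⊕ β, ∀ i, h' i = Sum.elim (initSeg g (σ j)) h (f i)) :
    Morley Q h' (g ∘ σ) k' := by
  intro j hj
  obtain ⟨f, hf⟩ := hh j hj
  refine Q.mono' (H (σ j) (hσ j hj)) (Sum.elim (fun p => Sum.inl (⟨σ p.1, hm _ _ p.1.2 hj⟩, p.2)) f)
    ?_
  rintro (x | x)
  · rfl
  · exact hf x

theorem Morley.mono {ζ β β' : Type} {Q : T.InvType ζ} {h : β → U} {g : ℕ → ζ → U} {k : ℕ}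
    (H : Morley Q h g k) (f : β' → β) {h' : β' → U} (e : ∀ i, h' i = h (f i)) :
    Morley Q h' g k := by
  intro j hj
  refine Q.mono' (H j hj) (Sum.map id f) ?_
  rintro (x | x)
  · rfl
  · exact e x

noncomputable def morleySeq {ζ β : Type} [Finite ζ] [Finite β] (Q : T.InvType ζ) (h : β → U) :
    ℕ → ζ → U
  | j => Classical.choose
      (Q.ex (Sum.elim (fun p : Fin j × ζ => morleySeq Q h p.1.1 p.2) h))
  termination_by j => j
  decreasing_by exact p.1.2

theorem morleySeq_spec {ζ β : Type} [Finite ζ] [Finite β] (Q : T.InvType ζ) (h : β → U) (k : ℕ) :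
    Morley Q h (morleySeq Q h) k := by
  intro j _
  have := Classical.choose_spec
    (Q.ex (Sum.elim (fun p : Fin j × ζ => morleySeq Q h p.1.1 p.2) h))
  rw [morleySeq.eq_def Q h j]
  exact this

theorem Morley.unique {ζ β : Type} [Finite ζ] [Finite β] {Q : T.InvType ζ} {h h' : β → U}
    {g g' : ℕ → ζ → U} (e : T.eqv h h') (k : ℕ) (H : Morley Q h g k) (H' : Morley Q h' g' k) :
    T.eqv (Sum.elim (initSeg g k) h) (Sum.elim (initSeg g' k) h') := by
  induction k with
  | zero =>
    refine e.of (Sum.elim (fun p => p.1.elim0) id) ?_ ?_ <;> rintro (x | x)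
    · exact x.1.elim0
    · rfl
    · exact x.1.elim0
    · rfl
  | succ k ih =>
    have ih := ih (H.le (Nat.le_succ _)) (H'.le (Nat.le_succ _))
    have := Q.inv ih (H k (Nat.lt_succ_self _)) (H' k (Nat.lt_succ_self _))
    refine this.of (Sum.elim (fun p => if hp : p.1.1 < k then Sum.inr (Sum.inl (⟨p.1, hp⟩, p.2))
      else Sum.inl p.2) (fun x => Sum.inr (Sum.inr x))) ?_ ?_
    all_goals
      rintro (x | x)
      · by_cases hx : x.1.1 < k
        · simp [hx, initSeg]
        · have : x.1.1 = k := by have := x.1.2; omega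
          simp [initSeg, this]
      · rfl

/-- the `k`-th power of `Q` -/
def Pow {ζ : Type} [Finite ζ] (Q : T.InvType ζ) (k : ℕ) : T.InvType (Fin k × ζ) where
  Rel := fun h D => ∃ g : ℕ → ζ → U, Morley Q h g k ∧ ∀ p, D p = initSeg g k p
  ex := fun h => ⟨_, morleySeq Q h, morleySeq_spec Q h k, fun _ => rfl⟩
  mono := by
    rintro β β' f h D ⟨g, hg, e⟩
    exact ⟨g, hg.mono f (fun _ => rfl), e⟩
  inv := by
    rintro β _ h h' D D' e ⟨g, hg, e1⟩ ⟨g', hg', e2⟩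
    have := Morley.unique e k hg hg'
    rwa [show D = initSeg g k from funext e1, show D' = initSeg g' k from funext e2]
  closure := by
    rintro β _ h h' D D' ⟨g, hg, e1⟩ e
    refine ⟨fun j z => if hj : j < k then D' (⟨j, hj⟩, z) else g j z, ?_, ?_⟩
    · intro j hj
      refine Q.closure (hg j hj) (e.of (Sum.elim (fun z => Sum.inl (⟨j, hj⟩, z)) (Sum.elim
        (fun p => Sum.inl (⟨p.1, p.1.2.trans hj⟩, p.2)) Sum.inr)) ?_ ?_)
      · rintro (x | x | x)
        · simp [e1, initSeg]
        · simp [e1, initSeg]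
        · rfl
      · rintro (x | x | x)
        · simp [hj]
        · have : x.1.1 < k := x.1.2.trans hj
          simp [initSeg, this]
        · rfl
    · intro p
      simp [initSeg]

end Sys
end

section
open Filter
namespace Sys
variable {U : Type w} {T : Sys U}

theorem ext_lemma {β δ : Type} [Finite β] [Finite δ] {r : Ultrafilter (δ → U)} (hC : T.Conc r)
    {c0 c1 : δ → U} (h0 : ∀ S, T.Def S → c0 ∈ S → S ∈ r) (h1 : T.uRel r c0 c1) (c : β → U) :
    ∃ 𝒱 : Ultrafilter (β ⊕ (δ ⊕ δ) → U), T.Conc 𝒱 ∧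
      (∀ S, T.Def S → Sum.elim c (Sum.elim c0 c1) ∈ S → S ∈ 𝒱) ∧
      ∀ A ∈ r, {v : β ⊕ (δ ⊕ δ) → U | v ∘ Sum.inr ∘ Sum.inl ∈ A ∧ v ∘ Sum.inr ∘ Sum.inr ∈ A} ∈ 𝒱 := by
  obtain ⟨𝒱, hV, hV'⟩ := exists_conc (T := T)
    {B : Set (β ⊕ (δ ⊕ δ) → U) | ∃ S, ∃ A ∈ r, T.Def S ∧ Sum.elim c (Sum.elim c0 c1) ∈ S ∧
      B = S ∩ {v | v ∘ Sum.inr ∘ Sum.inl ∈ A ∧ v ∘ Sum.inr ∘ Sum.inr ∈ A}}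
    ⟨_, Set.univ, Set.univ, univ_mem, T.univ, trivial, rfl⟩
    (by
      rintro _ ⟨S, A, hA, hS, hc, rfl⟩ _ ⟨S', A', hA', hS', hc', rfl⟩
      refine ⟨_, ⟨S ∩ S', A ∩ A', inter_mem hA hA', T.inter hS hS', ⟨hc, hc'⟩, rfl⟩, ?_⟩
      rintro v ⟨⟨h1, h2⟩, ⟨h3, h4⟩, h5, h6⟩
      exact ⟨⟨h1, h3, h5⟩, h2, h4, h6⟩)
    (by
      rintro _ ⟨S, A, hA, hS, hc, rfl⟩
      -- S' (y1, y0)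
      have hS' : T.Def {v : δ ⊕ δ → U | ∃ w : β → U,
          Sum.elim w v ∈ {v : β ⊕ (δ ⊕ δ) → U | v ∘ Sum.map id Sum.swap ∈ S}} :=
        T.proj (T.pre _ hS)
      have e1 : Sum.elim c1 c0 ∈ {v : δ ⊕ δ → U | ∃ w : β → U,
          Sum.elim w v ∈ {v : β ⊕ (δ ⊕ δ) → U | v ∘ Sum.map id Sum.swap ∈ S}} := by
        refine ⟨c, mcong' (S := S) hc ?_⟩
        rintro (x | x | x) <;> rfl
      obtain ⟨y1, h1, hM1, hA1⟩ := (((h1 _ hS').1 e1).and (hC.and hA)).exists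
      obtain ⟨y0, h0, hM0, hA0⟩ := (Eventually.and
        (show ∀ᶠ y0 in (r : Filter (δ → U)), Sum.elim y1 y0 ∈ _ from
          h0 _ (T.fiber hS' y1 hM1) h1) (hC.and hA)).exists
      obtain ⟨w, hw⟩ := h0
      have hSf : T.Def {w : β → U | Sum.elim w (Sum.elim y0 y1) ∈ S} := by
        have := T.fiber (T.pre Sum.swap hS) (Sum.elim y0 y1) (by rintro (x | x) <;> simp [*])
        convert this using 1
        ext w
        simp only [Set.mem_ofPred_eq]
        rw [show Sum.elim (Sum.elim y0 y1) w ∘ Sum.swap = Sum.elim w (Sum.elim y0 y1) by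
          funext x; rcases x with x | x <;> rfl]
      obtain ⟨w', hw', hMw⟩ := T.tv hSf ⟨w, mcong' (S := S) hw (by
        rintro (x | x | x) <;> rfl)⟩
      refine ⟨Sum.elim w' (Sum.elim y0 y1), ⟨hw', hA0, hA1⟩, ?_⟩
      rintro (x | x | x) <;> simp [*])
  refine ⟨𝒱, hV, fun S hS hc => ?_, fun A hA => ?_⟩
  · exact mem_of_superset (hV' _ ⟨S, Set.univ, univ_mem, hS, hc, rfl⟩) Set.inter_subset_left
  · exact mem_of_superset (hV' _ ⟨Set.univ, A, hA, T.univ, trivial, rfl⟩) Set.inter_subset_right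

variable (T) in
def Bad {γ δ : Type} (φ : Set (γ ⊕ δ → U)) (a : δ → U) : Prop :=
  T.Def φ ∧ ∃ k : ℕ, ∀ {β : Type} [Finite β] (c : β → U), ∃ Q : T.InvType (β ⊕ δ),
    Q.Rel (Empty.elim : Empty → U) (Sum.elim c a) ∧
    ∀ g : ℕ → β ⊕ δ → U, Morley Q (Empty.elim : Empty → U) g k → ∀ y : γ → U,
      ∃ j < k, Sum.elim y (g j ∘ Sum.inr) ∉ φ

/-- the set of `y` on which `ξ(y,c0)` and `ξ(y,c1)` differ -/
def diffSet {γ δ : Type} (ξ : Set (γ ⊕ δ → U)) : Set (γ ⊕ (δ ⊕ δ) → U) :=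
  {v | ¬ (v ∘ Sum.map id Sum.inl ∈ ξ ↔ v ∘ Sum.map id Sum.inr ∈ ξ)}

theorem diffSet_def {γ δ : Type} {ξ : Set (γ ⊕ δ → U)} (h : T.Def ξ) : T.Def (diffSet ξ) := by
  have h1 := T.pre (Sum.map id Sum.inl : γ ⊕ δ → γ ⊕ (δ ⊕ δ)) h
  have h2 := T.pre (Sum.map id Sum.inr : γ ⊕ δ → γ ⊕ (δ ⊕ δ)) h
  have := T.compl (Def_union (T.inter h1 h2) (T.inter (T.compl h1) (T.compl h2)))
  convert this using 1
  ext v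
  simp only [diffSet, Set.mem_ofPred_eq, Set.mem_compl_iff, Set.mem_union, Set.mem_inter_iff]
  tauto

theorem bad_pair {γ δ : Type} [Finite γ] [Finite δ] {ξ : Set (γ ⊕ δ → U)} (hξ : T.Def ξ)
    {r : Ultrafilter (δ → U)} (hC : T.Conc r)
    {c0 c1 : δ → U} (h0 : ∀ S, T.Def S → c0 ∈ S → S ∈ r) (h1 : T.uRel r c0 c1) :
    T.Bad (diffSet ξ) (Sum.elim c0 c1) := by
  classical
  refine ⟨diffSet_def hξ, ?_⟩
  obtain ⟨d, hd⟩ := T.nip (T.pre Sum.swap hξ)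
  refine ⟨d, fun {β} _ c => ?_⟩
  obtain ⟨𝒱, hV, hV1, hV2⟩ := ext_lemma hC h0 h1 c
  refine ⟨ofUltra 𝒱 hV.inv, uRel_empty _ hV1, fun g hg y => ?_⟩
  by_contra hcon
  push Not at hcon
  have marg : ∀ (ι : Type) (h : ι → U) (v : β ⊕ (δ ⊕ δ) → U), T.uRel 𝒱 h v → ∀ s : Bool,
      T.uRel r h (v ∘ Sum.inr ∘ (if s then Sum.inl else Sum.inr)) := by
    intro ι h v hv s
    refine uRel_mem fun S hS hr => ?_
    have := (hv {v | v ∘ Sum.map (Sum.inr ∘ (if s then Sum.inl else Sum.inr)) id ∈ S}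
      (T.pre _ hS)).2 ?_
    · refine mcong' (S := S) this ?_
      rintro (x | x) <;> rfl
    · filter_upwards [hV2 _ hr] with v hv
      have h2 : Sum.elim (v ∘ Sum.inr ∘ (if s then Sum.inl else Sum.inr)) h ∈ S := by
        cases s
        · exact hv.2
        · exact hv.1
      refine mcong' (S := S) h2 ?_
      rintro (x | x) <;> rfl
  have path : ∀ ε : ℕ → Bool, Morley (ofUltra r hC.inv) (Empty.elim : Empty → U)
      (fun j => g j ∘ Sum.inr ∘ (if ε j then Sum.inl else Sum.inr)) d := by
    intro ε j hj
    refine (ofUltra r hC.inv).mono' (marg _ _ _ (hg j hj) (ε j))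
      (Sum.map (fun p => (p.1, Sum.inr ((if ε p.1 then Sum.inl else Sum.inr) p.2))) id) ?_
    rintro (x | x) <;> rfl
  have uniq := fun ε ε' => Morley.unique (eqv.refl _) d (path ε) (path ε')
  have key : ∀ X : Set (Fin d), ∃ y' : γ → U, ∀ i : Fin d,
      Sum.elim (g i ∘ Sum.inr ∘ Sum.inl) y' ∈ {v : δ ⊕ γ → U | v ∘ Sum.swap ∈ ξ} ↔ i ∈ X := by
    intro X
    -- choose path
    let ε : ℕ → Bool := fun j => if h : j < d then
      decide ((Sum.elim y (g j ∘ Sum.inr ∘ Sum.inl) ∈ ξ) ↔ (⟨j, h⟩ : Fin d) ∈ X) else true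
    have hε : ∀ i : Fin d, Sum.elim y (g i ∘ Sum.inr ∘ (if ε i then Sum.inl else Sum.inr)) ∈ ξ ↔
        i ∈ X := by
      intro i
      have h1 := hcon i i.2
      have h2 : ¬ (Sum.elim y (g i ∘ Sum.inr ∘ Sum.inl) ∈ ξ ↔
        Sum.elim y (g i ∘ Sum.inr ∘ Sum.inr) ∈ ξ) := by
        have h1 : ¬ (Sum.elim y (g i ∘ Sum.inr) ∘ Sum.map id Sum.inl ∈ ξ ↔
          Sum.elim y (g i ∘ Sum.inr) ∘ Sum.map id Sum.inr ∈ ξ) := h1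
        rwa [Sum.elim_comp_map, Sum.elim_comp_map] at h1
      have hb : ε i = decide ((Sum.elim y (g i ∘ Sum.inr ∘ Sum.inl) ∈ ξ) ↔ i ∈ X) := by
        simp [ε]
      by_cases h3 : (Sum.elim y (g i ∘ Sum.inr ∘ Sum.inl) ∈ ξ) ↔ i ∈ X
      · simp only [hb, h3, decide_true, if_true]
      · simp only [hb, h3, decide_false]
        simp only [Bool.false_eq_true, if_false]
        tauto
    obtain ⟨y', hy'⟩ := (uniq ε fun _ => true).extend y
    refine ⟨y', fun i => ?_⟩
    rw [← hε i]
    have := (hy'.of (δ := γ ⊕ δ) (Sum.map id fun z => Sum.inl (i, z)) (fun _ => rfl)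
      (fun _ => rfl)) ξ hξ
    refine (Iff.trans (mcong (S := ξ) ?_) this.symm).trans (mcong (S := ξ) ?_)
    · rintro (x | x) <;> rfl
    · rintro (x | x) <;> rfl
  choose b hb using key
  exact hd ⟨fun i => g i ∘ Sum.inr ∘ Sum.inl, b, fun i X => hb X i⟩

variable (T) in
def Red {γ κ : Type} (Γ : Set (γ ⊕ κ → U)) (c : κ → U) : Prop :=
  T.Def Γ ∧ ∀ {β ε : Type} [Finite β] [Finite ε] (ψ : Set (γ ⊕ β → U)) (c0 : β → U)
    (Θ : Set (γ ⊕ ε → U)) (R : T.InvType ε) (D : ε → U), T.Def ψ → T.Def Θ →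
    R.Rel (Sum.elim c0 c) D →
    (∀ y : γ → U, Sum.elim y c0 ∈ ψ ∨ Sum.elim y c ∈ Γ ∨ Sum.elim y D ∈ Θ) →
    ∃ (F : Type) (_ : Finite F) (e : F × β → U) (D' : ε → U),
      (∀ f, T.eqv (fun i => e (f, i)) c0) ∧ R.Rel e D' ∧
      ∀ y : γ → U, (∃ f, Sum.elim y (fun i => e (f, i)) ∈ ψ) ∨ Sum.elim y D' ∈ Θ

theorem Red.of {γ κ κ' : Type} {Γ : Set (γ ⊕ κ → U)} {c : κ → U} (H : T.Red Γ c)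
    {Γ' : Set (γ ⊕ κ' → U)} (hΓ' : T.Def Γ') {c' : κ' → U} (f : κ → κ') (hc : ∀ i, c i = c' (f i))
    (hy : ∀ y, Sum.elim y c' ∈ Γ' → Sum.elim y c ∈ Γ) : T.Red Γ' c' := by
  refine ⟨hΓ', fun {β ε} _ _ ψ c0 Θ R D hψ hΘ hR hcov => ?_⟩
  refine H.2 ψ c0 Θ R D hψ hΘ (R.mono' hR (Sum.map id f) ?_) fun y => ?_
  · rintro (x | x)
    · rfl
    · exact hc x
  · rcases hcov y with h | h | h
    · exact Or.inl h
    · exact Or.inr (Or.inl (hy y h))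
    · exact Or.inr (Or.inr h)

theorem Red.base {γ κ : Type} (c : κ → U) : T.Red (∅ : Set (γ ⊕ κ → U)) c := by
  refine ⟨Def_empty, fun {β ε} _ _ ψ c0 Θ R D hψ hΘ hR hcov => ?_⟩
  refine ⟨Unit, inferInstance, fun p => c0 p.2, D, fun _ => eqv.refl _,
    R.mono' hR (fun p => Sum.inl p.2) (fun _ => rfl), fun y => ?_⟩
  rcases hcov y with h | h | h
  · exact Or.inl ⟨(), h⟩
  · exact h.elim
  · exact Or.inr h

/-- Definability of a cover condition -/
theorem cover_def {γ κ : Type} [Finite γ] {S : Set (γ ⊕ κ → U)} (h : T.Def S) {c c' : κ → U}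
    (e : T.eqv c c') : (∀ y : γ → U, Sum.elim y c ∈ S) → ∀ y : γ → U, Sum.elim y c' ∈ S :=
  (e _ (Def_forall h)).1

theorem Red.eqv {γ κ : Type} [Finite γ] [Finite κ] {Γ : Set (γ ⊕ κ → U)} {c c' : κ → U}
    (H : T.Red Γ c) (e : T.eqv c c') : T.Red Γ c' := by
  refine ⟨H.1, fun {β ε} _ _ ψ c0 Θ R D hψ hΘ hR hcov => ?_⟩
  obtain ⟨z, hz⟩ := e.symm.extend (Sum.elim D c0)
  have hz' : T.eqv (Sum.elim D (Sum.elim c0 c'))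
      (Sum.elim (z ∘ Sum.inl) (Sum.elim (z ∘ Sum.inr) c)) := by
    refine hz.of (Equiv.sumAssoc _ _ _).symm ?_ ?_ <;> rintro (x | x | x) <;> rfl
  have hR' := R.closure hR hz'
  have hS : T.Def ({v : γ ⊕ (ε ⊕ (β ⊕ κ)) → U | v ∘ Sum.map id (Sum.inr ∘ Sum.inl) ∈ ψ} ∪
      ({v | v ∘ Sum.map id (Sum.inr ∘ Sum.inr) ∈ Γ} ∪ {v | v ∘ Sum.map id Sum.inl ∈ Θ})) :=
    Def_union (T.pre _ hψ) (Def_union (T.pre _ H.1) (T.pre _ hΘ))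
  have aux : ∀ (y : γ → U) (D : ε → U) (c0 : β → U) (c : κ → U),
      Sum.elim y (Sum.elim D (Sum.elim c0 c)) ∈
      ({v : γ ⊕ (ε ⊕ (β ⊕ κ)) → U | v ∘ Sum.map id (Sum.inr ∘ Sum.inl) ∈ ψ} ∪
      ({v | v ∘ Sum.map id (Sum.inr ∘ Sum.inr) ∈ Γ} ∪ {v | v ∘ Sum.map id Sum.inl ∈ Θ})) ↔
      (Sum.elim y c0 ∈ ψ ∨ Sum.elim y c ∈ Γ ∨ Sum.elim y D ∈ Θ) := by
    intro y D c0 c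
    refine or_congr (mcong (S := ψ) ?_) (or_congr (mcong (S := Γ) ?_) (mcong (S := Θ) ?_)) <;>
    rintro (x | x) <;> rfl
  have := cover_def hS hz' (fun y => (aux _ _ _ _).2 (hcov y))
  obtain ⟨F, hF, e', D', h1, h2, h3⟩ := H.2 ψ (z ∘ Sum.inr) Θ R (z ∘ Sum.inl) hψ hΘ hR'
    (fun y => (aux _ _ _ _).1 (this y))
  refine ⟨F, hF, e', D', fun f => (h1 f).trans ?_, h2, h3⟩
  exact (hz.of (fun i => Sum.inl (Sum.inr i)) (fun _ => rfl) (fun _ => rfl)).symm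

end Sys
end

section
open Filter
namespace Sys
variable {U : Type w} {T : Sys U}

theorem Red.inner {γ κ β δ ε : Type} [Finite γ] [Finite κ] [Finite β] [Finite δ] [Finite ε]
    {Γ : Set (γ ⊕ κ → U)} {ψ : Set (γ ⊕ β → U)} {Θ : Set (γ ⊕ ε → U)} (hψ : T.Def ψ)
    (hΘ : T.Def Θ) (Q : T.InvType ((β ⊕ κ) ⊕ δ)) (R : T.InvType ε)
    {c0 : β → U} {c : κ → U} {a : δ → U}
    (hQ : Q.Rel (Empty.elim : Empty → U) (Sum.elim (Sum.elim c0 c) a)) (hRed : T.Red Γ c) (k : ℕ) :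
    ∀ (F : Type) [Finite F] (e : F × β → U) (g : ℕ → (β ⊕ κ) ⊕ δ → U) (D : ε → U),
    (∀ f, T.eqv (fun i => e (f, i)) c0) → Morley Q e g k → R.Rel (Sum.elim (initSeg g k) e) D →
    (∀ y : γ → U, (∃ f, Sum.elim y (fun i => e (f, i)) ∈ ψ) ∨
      (∃ j < k, Sum.elim y (fun i => g j (Sum.inl (Sum.inl i))) ∈ ψ ∨
        Sum.elim y (fun i => g j (Sum.inl (Sum.inr i))) ∈ Γ) ∨ Sum.elim y D ∈ Θ) →
    ∃ (F : Type) (_ : Finite F) (e : F × β → U) (D' : ε → U),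
      (∀ f, T.eqv (fun i => e (f, i)) c0) ∧ R.Rel e D' ∧
      ∀ y : γ → U, (∃ f, Sum.elim y (fun i => e (f, i)) ∈ ψ) ∨ Sum.elim y D' ∈ Θ := by
  induction k with
  | zero =>
    intro F _ e g D he hg hR hcov
    refine ⟨F, inferInstance, e, D, he, R.mono' hR Sum.inr (fun _ => rfl), fun y => ?_⟩
    rcases hcov y with h | ⟨j, hj, _⟩ | h
    · exact Or.inl h
    · omega
    · exact Or.inr h
  | succ k ih =>
    intro F _ e g D he hg hR hcov
    have hg0 : T.eqv (g 0) (Sum.elim (Sum.elim c0 c) a) := by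
      have := Q.inv (eqv.refl _) (Q.mono' (hg 0 (Nat.succ_pos _)) (β' := Empty) Empty.elim
        (g := Empty.elim) (fun i => i.elim)) hQ
      exact this.of Sum.inl (fun _ => rfl) (fun _ => rfl)
    let c' : κ → U := fun i => g 0 (Sum.inl (Sum.inr i))
    have hRed' : T.Red Γ c' := hRed.eqv
      (hg0.of (fun i => Sum.inl (Sum.inr i)) (fun _ => rfl) (fun _ => rfl)).symm
    let p0 : (F × β) ⊕ β → U := Sum.elim e (fun i => g 0 (Sum.inl (Sum.inl i)))
    let D1 : ε ⊕ (Fin k × ((β ⊕ κ) ⊕ δ)) → U := Sum.elim D (initSeg (g ∘ Nat.succ) k)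
    let ψ' : Set (γ ⊕ ((F × β) ⊕ β) → U) :=
      {v | ∃ f : F, v ∈ {v | v ∘ Sum.map id (fun i => Sum.inl (f, i)) ∈ ψ}} ∪
      {v | v ∘ Sum.map id Sum.inr ∈ ψ}
    let Θ' : Set (γ ⊕ (ε ⊕ (Fin k × ((β ⊕ κ) ⊕ δ))) → U) :=
      {v | ∃ j : Fin k, v ∈ ({v | v ∘ Sum.map id (fun i => Sum.inr (j, Sum.inl (Sum.inl i))) ∈ ψ} ∪
        {v | v ∘ Sum.map id (fun i => Sum.inr (j, Sum.inl (Sum.inr i))) ∈ Γ})} ∪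
      {v | v ∘ Sum.map id Sum.inl ∈ Θ}
    have hψ' : T.Def ψ' := Def_union (Def_iUnion fun f => T.pre _ hψ) (T.pre _ hψ)
    have hΘ' : T.Def Θ' := Def_union
      (Def_iUnion fun j => Def_union (T.pre _ hψ) (T.pre _ hRed.1)) (T.pre _ hΘ)
    have mψ' : ∀ (y : γ → U) (p : (F × β) ⊕ β → U), Sum.elim y p ∈ ψ' ↔
        (∃ f, Sum.elim y (fun i => p (Sum.inl (f, i))) ∈ ψ) ∨
        Sum.elim y (fun i => p (Sum.inr i)) ∈ ψ := by
      intro y p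
      refine or_congr (exists_congr fun f => mcong (S := ψ) ?_) (mcong (S := ψ) ?_) <;>
      rintro (x | x) <;> rfl
    have mΘ' : ∀ (y : γ → U) (p : ε ⊕ (Fin k × ((β ⊕ κ) ⊕ δ)) → U), Sum.elim y p ∈ Θ' ↔
        (∃ j : Fin k, Sum.elim y (fun i => p (Sum.inr (j, Sum.inl (Sum.inl i)))) ∈ ψ ∨
          Sum.elim y (fun i => p (Sum.inr (j, Sum.inl (Sum.inr i)))) ∈ Γ) ∨
        Sum.elim y (fun i => p (Sum.inl i)) ∈ Θ := by
      intro y p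
      refine or_congr (exists_congr fun f => or_congr (mcong (S := ψ) ?_) (mcong (S := Γ) ?_))
        (mcong (S := Θ) ?_) <;>
      rintro (x | x) <;> rfl
    obtain ⟨F2, hF2, e2, D2, h1, ⟨⟨g', hg', hD2⟩, hR2⟩, h3⟩ := hRed'.2 ψ' p0 Θ'
      ((Pow Q k).tensor R) D1 hψ' hΘ'
      ⟨⟨g ∘ Nat.succ, hg.sub (k' := k) Nat.succ (fun j hj => by simpa using hj)
        (fun i j hij _ => by simpa using hij) (fun j _ =>
          ⟨Sum.elim (Sum.elim Sum.inr (fun i => Sum.inl (⟨0, Nat.succ_pos _⟩, Sum.inl (Sum.inl i))))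
            (fun i => Sum.inl (⟨0, Nat.succ_pos _⟩, Sum.inl (Sum.inr i))), by
            rintro ((x | x) | x) <;> rfl⟩), fun _ => rfl⟩,
        R.mono' hR (Sum.elim (fun p => Sum.inl (p.1.succ, p.2)) (Sum.elim
          (Sum.elim Sum.inr (fun i => Sum.inl (0, Sum.inl (Sum.inl i))))
            (fun i => Sum.inl (0, Sum.inl (Sum.inr i))))) (by
            rintro (x | (x | x) | x) <;> rfl)⟩
      (by
        intro y
        rw [mψ', mΘ']
        rcases hcov y with h | ⟨j, hj, h⟩ | h
        · exact Or.inl (Or.inl h)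
        · rcases j with _ | j
          · rcases h with h | h
            · exact Or.inl (Or.inr h)
            · exact Or.inr (Or.inl h)
          · exact Or.inr (Or.inr (Or.inl ⟨⟨j, by omega⟩, h⟩))
        · exact Or.inr (Or.inr (Or.inr h)))
    let tr : (F2 × (F ⊕ Unit)) × β → F2 × ((F × β) ⊕ β) := fun q =>
      (q.1.1, Sum.elim (fun f => Sum.inl (f, q.2)) (fun _ => Sum.inr q.2) q.1.2)
    refine ih (F2 × (F ⊕ Unit)) (fun q => e2 (tr q)) g' (D2 ∘ Sum.inl) ?_
      (hg'.mono tr (fun _ => rfl)) (R.mono' hR2 (Sum.map id tr) ?_) ?_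
    · rintro ⟨f2, f | u⟩
      · exact ((h1 f2).of (fun i => Sum.inl (f, i)) (fun _ => rfl) (fun _ => rfl)).trans (he f)
      · refine ((h1 f2).of (fun i => Sum.inr i) (fun _ => rfl) (fun _ => rfl)).trans
          (hg0.of (fun i => Sum.inl (Sum.inl i)) (fun _ => rfl) (fun _ => rfl))
    · rintro (x | x)
      · exact (hD2 x).symm
      · rfl
    · intro y
      rcases h3 y with ⟨f2, h⟩ | h
      · rw [mψ'] at h
        rcases h with ⟨f, h⟩ | h
        · exact Or.inl ⟨(f2, Sum.inl f), h⟩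
        · exact Or.inl ⟨(f2, Sum.inr ()), h⟩
      · rw [mΘ'] at h
        rcases h with ⟨j, h⟩ | h
        · refine Or.inr (Or.inl ⟨j, j.2, ?_⟩)
          refine h.imp (fun h => mcong' h ?_) (fun h => mcong' h ?_)
          all_goals
            rintro (x | x)
            · rfl
            · exact (hD2 (j, _)).symm
        · exact Or.inr (Or.inr h)

/-- union with paired parameters -/
def pun {γ κ δ : Type} (Γ : Set (γ ⊕ κ → U)) (φ : Set (γ ⊕ δ → U)) : Set (γ ⊕ (κ ⊕ δ) → U) :=
  {v | v ∘ Sum.map id Sum.inl ∈ Γ} ∪ {v | v ∘ Sum.map id Sum.inr ∈ φ}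

theorem pun_def {γ κ δ : Type} {Γ : Set (γ ⊕ κ → U)} {φ : Set (γ ⊕ δ → U)} (h : T.Def Γ)
    (h' : T.Def φ) : T.Def (pun Γ φ) := Def_union (T.pre _ h) (T.pre _ h')

theorem mem_pun {γ κ δ : Type} {Γ : Set (γ ⊕ κ → U)} {φ : Set (γ ⊕ δ → U)} {y : γ → U}
    {c : κ ⊕ δ → U} : Sum.elim y c ∈ pun Γ φ ↔
      Sum.elim y (fun i => c (Sum.inl i)) ∈ Γ ∨ Sum.elim y (fun i => c (Sum.inr i)) ∈ φ := by
  refine or_congr (mcong (S := Γ) ?_) (mcong (S := φ) ?_) <;> rintro (x | x) <;> rfl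

theorem Red.step {γ κ δ : Type} [Finite γ] [Finite κ] [Finite δ] {Γ : Set (γ ⊕ κ → U)} {c : κ → U}
    (H : T.Red Γ c) {φ : Set (γ ⊕ δ → U)} {a : δ → U} (hb : T.Bad φ a) :
    T.Red (pun Γ φ) (Sum.elim c a) := by
  refine ⟨pun_def H.1 hb.1, fun {β ε} _ _ ψ c0 Θ R D hψ hΘ hR hcov => ?_⟩
  obtain ⟨hφ, k, hk⟩ := hb
  obtain ⟨Q, hQ, hQ'⟩ := hk (Sum.elim c0 c)
  let g := morleySeq Q (Empty.elim : Empty → U)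
  have hg : Morley Q (Empty.elim : Empty → U) g k := morleySeq_spec Q _ k
  obtain ⟨D1, hD1⟩ := R.ex (Sum.elim (initSeg g k) (Empty.elim : Empty → U))
  have hgj : ∀ j < k, T.eqv (Sum.elim (Sum.elim c0 c) a) (g j) := fun j hj =>
    (Q.inv (eqv.refl _) hQ (Q.mono' (hg j hj) (β' := Empty) Empty.elim
        (g := Empty.elim) (fun i => i.elim))).of Sum.inl (fun _ => rfl) (fun _ => rfl)
  -- the cover set
  let S : Set (γ ⊕ (ε ⊕ ((β ⊕ κ) ⊕ δ)) → U) :=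
    {v | v ∘ Sum.map id (fun i => Sum.inr (Sum.inl (Sum.inl i))) ∈ ψ} ∪
    ({v | v ∘ Sum.map id (fun i => Sum.inr (Sum.inl (Sum.inr i))) ∈ Γ} ∪
    ({v | v ∘ Sum.map id (fun i => Sum.inr (Sum.inr i)) ∈ φ} ∪ {v | v ∘ Sum.map id Sum.inl ∈ Θ}))
  have hS : T.Def S := Def_union (T.pre _ hψ) (Def_union (T.pre _ H.1)
    (Def_union (T.pre _ hφ) (T.pre _ hΘ)))
  have mS : ∀ (y : γ → U) (D : ε → U) (p : (β ⊕ κ) ⊕ δ → U), Sum.elim y (Sum.elim D p) ∈ S ↔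
      Sum.elim y (fun i => p (Sum.inl (Sum.inl i))) ∈ ψ ∨
      Sum.elim y (fun i => p (Sum.inl (Sum.inr i))) ∈ Γ ∨
      Sum.elim y (fun i => p (Sum.inr i)) ∈ φ ∨ Sum.elim y D ∈ Θ := by
    intro y D p
    refine or_congr (mcong (S := ψ) ?_) (or_congr (mcong (S := Γ) ?_)
      (or_congr (mcong (S := φ) ?_) (mcong (S := Θ) ?_))) <;>
    rintro (x | x) <;> rfl
  have hRa : R.Rel (Sum.elim (Sum.elim c0 c) a) D := R.mono' hR (Equiv.sumAssoc _ _ _) (by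
    rintro ((x | x) | x) <;> rfl)
  have hcov1 : ∀ j < k, ∀ y : γ → U, Sum.elim y (Sum.elim D1 (g j)) ∈ S := by
    intro j hj
    have hR1 : R.Rel (g j) D1 := R.mono' hD1 (fun z => Sum.inl (⟨j, hj⟩, z)) (fun _ => rfl)
    refine cover_def hS (R.inv (hgj j hj) hRa hR1) fun y => ?_
    rw [mS]
    have := hcov y
    rw [mem_pun] at this
    tauto
  refine Red.inner hψ hΘ Q R hQ H k Empty (fun p => p.1.elim) g D1 (fun f => f.elim)
    (hg.mono (fun p => p.1.elim) (fun p => p.1.elim))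
    (R.mono' hD1 (Sum.map id (fun p => p.1.elim)) ?_) fun y => ?_
  · rintro (x | x)
    · rfl
    · exact x.1.elim
  · obtain ⟨j, hj, hn⟩ := hQ' g hg y
    have := (mS _ _ _).1 (hcov1 j hj y)
    rcases this with h | h | h | h
    · exact Or.inr (Or.inl ⟨j, hj, Or.inl h⟩)
    · exact Or.inr (Or.inl ⟨j, hj, Or.inr h⟩)
    · exact (hn h).elim
    · exact Or.inr (Or.inr h)

variable (T) in
def Red' {γ κ : Type} (Γ : Set (γ ⊕ κ → U)) (c : κ → U) : Prop :=
  ∀ {κ' : Type} [Finite κ'] (Γ' : Set (γ ⊕ κ' → U)) (c' : κ' → U), T.Red Γ' c' →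
    T.Red (pun Γ' Γ) (Sum.elim c' c)

theorem Red'.red {γ κ : Type} {Γ : Set (γ ⊕ κ → U)} {c : κ → U} (hΓ : T.Def Γ)
    (H : T.Red' Γ c) : T.Red Γ c := by
  refine (H (∅ : Set (γ ⊕ Empty → U)) Empty.elim (Red.base _)).of hΓ
    (Sum.elim Empty.elim id) (by rintro (x | x); exact x.elim; rfl) fun y hy => ?_
  rw [mem_pun]; exact Or.inr hy

theorem Red'.pun {γ κ δ : Type} [Finite κ] [Finite δ] {Γ : Set (γ ⊕ κ → U)} {c : κ → U}
    {φ : Set (γ ⊕ δ → U)} {a : δ → U} (hΓ : T.Def Γ) (hφ : T.Def φ)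
    (H : T.Red' Γ c) (H' : T.Red' φ a) : T.Red' (pun Γ φ) (Sum.elim c a) := by
  intro κ' _ Γ' c' h
  refine (H' _ _ (H _ _ h)).of (pun_def h.1 (pun_def hΓ hφ)) (Equiv.sumAssoc _ _ _)
    (by rintro ((x | x) | x) <;> rfl) fun y => ?_
  simp only [mem_pun, Sum.elim_inl, Sum.elim_inr]
  tauto

theorem Red'.base {γ : Type} : T.Red' (∅ : Set (γ ⊕ Empty → U)) Empty.elim := by
  intro κ' _ Γ' c' h
  refine h.of (pun_def h.1 Def_empty) Sum.inl (fun _ => rfl) fun y => ?_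
  simp only [mem_pun, Set.mem_empty_iff_false, or_false]
  exact id

theorem exists_inv {γ : Type} [Finite γ]
    (N : ∀ {β : Type}, Set (γ ⊕ β → U) → (β → U) → Prop)
    (hDef : ∀ {β : Type} {ψ : Set (γ ⊕ β → U)} {c : β → U}, N ψ c → T.Def ψ)
    (hinv : ∀ {β : Type} [Finite β] {ψ : Set (γ ⊕ β → U)} {c c' : β → U}, T.eqv c c' →
      N ψ c → N ψ c')
    (hun : ∀ {β β' : Type} [Finite β] [Finite β'] {ψ : Set (γ ⊕ β → U)} {c : β → U}
      {ψ' : Set (γ ⊕ β' → U)} {c' : β' → U}, N ψ c → N ψ' c' → N (pun ψ ψ') (Sum.elim c c'))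
    (hex : N (∅ : Set (γ ⊕ Empty → U)) Empty.elim)
    (hprop : ∀ {β F : Type} [Finite β] [Finite F] {ψ : Set (γ ⊕ β → U)} (e : F → β → U),
      (∀ f, N ψ (e f)) → ∃ y, ∀ f, Sum.elim y (e f) ∉ ψ) :
    ∃ 𝒰 : Ultrafilter (γ → U), T.Inv 𝒰 ∧ ∀ {β : Type} [Finite β] (ψ : Set (γ ⊕ β → U)) (c : β → U),
      N ψ c → ∀ᶠ y in 𝒰, Sum.elim y c ∉ ψ := by
  obtain ⟨𝒰, h𝒰⟩ := exists_ultra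
    {B : Set (γ → U) | ∃ (β : Type) (_ : Finite β) (ψ : Set (γ ⊕ β → U)) (c : β → U)
      (κ : Type) (_ : Finite κ) (Γ : Set (γ ⊕ κ → U)) (a : κ → U), N ψ c ∧ T.Def Γ ∧
      T.Red' Γ a ∧ B = {y | Sum.elim y c ∉ ψ ∧ Sum.elim y a ∉ Γ}}
    ⟨_, Empty, inferInstance, ∅, Empty.elim, Empty, inferInstance, ∅, Empty.elim, hex, Def_empty,
      Red'.base, rfl⟩
    (by
      rintro _ ⟨β, _, ψ, c, κ, _, Γ, a, h1, h2, h3, rfl⟩ _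
        ⟨β', _, ψ', c', κ', _, Γ', a', h1', h2', h3', rfl⟩
      refine ⟨_, ⟨β ⊕ β', inferInstance, pun ψ ψ', Sum.elim c c', κ ⊕ κ', inferInstance,
        pun Γ Γ', Sum.elim a a', hun h1 h1', pun_def h2 h2', h3.pun h2 h2' h3', rfl⟩, ?_⟩
      rintro y ⟨h4, h5⟩
      rw [mem_pun] at h4 h5
      push Not at h4 h5
      exact ⟨⟨h4.1, h5.1⟩, h4.2, h5.2⟩)
    (by
      rintro _ ⟨β, _, ψ, c, κ, _, Γ, a, h1, h2, h3, rfl⟩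
      by_contra hne
      rw [Set.not_nonempty_iff_eq_empty, Set.eq_empty_iff_forall_notMem] at hne
      obtain ⟨r, hr, _⟩ := exists_coheir (T := T) (Empty.elim : Empty → U)
      obtain ⟨D, hD⟩ := (ofUltra r hr.inv).ex (Sum.elim c a)
      obtain ⟨F, _, e, D', h4, h5, h6⟩ := (h3.red h2).2 ψ c ∅ _ D (hDef h1) Def_empty hD
        (fun y => by
          have := hne y
          by_contra hcon
          push Not at hcon
          exact this ⟨hcon.1, hcon.2.1⟩)
      obtain ⟨y, hy⟩ := hprop (fun f i => e (f, i)) fun f => hinv (h4 f).symm h1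
      rcases h6 y with ⟨f, h⟩ | h
      · exact hy f h
      · exact h)
  have hN : ∀ {β : Type} [Finite β] (ψ : Set (γ ⊕ β → U)) (c : β → U),
      N ψ c → ∀ᶠ y in 𝒰, Sum.elim y c ∉ ψ := by
    intro β _ ψ c h
    refine mem_of_superset (h𝒰 _ ⟨β, inferInstance, ψ, c, Empty, inferInstance, ∅, Empty.elim, h,
      Def_empty, Red'.base, rfl⟩) fun y hy => hy.1
  have hB : ∀ {δ : Type} [Finite δ] (φ : Set (γ ⊕ δ → U)) (a : δ → U), T.Bad φ a →
      ∀ᶠ y in 𝒰, Sum.elim y a ∉ φ := by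
    intro δ _ φ a h
    refine mem_of_superset (h𝒰 _ ⟨Empty, inferInstance, ∅, Empty.elim, δ, inferInstance, φ, a, hex,
      h.1, ?_, rfl⟩) fun y hy => hy.2
    intro κ' _ Γ' c' h'
    exact h'.step h
  refine ⟨𝒰, ?_, hN⟩
  intro β _ S hS c c' e h
  obtain ⟨r, hr, hr'⟩ := exists_coheir (T := T) c
  obtain ⟨c1, hc1⟩ := uRel_ex (T := T) r (Sum.elim c c')
  have b1 := bad_pair hS hr hr' ((ofUltra r hr.inv).mono' hc1 Sum.inl (fun _ => rfl))
  have b2 := bad_pair hS hr (fun S hS hc => hr' S hS ((e S hS).2 hc))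
    ((ofUltra r hr.inv).mono' hc1 Sum.inr (fun _ => rfl))
  filter_upwards [h, hB _ _ b1, hB _ _ b2] with y h1 h2 h3
  simp only [diffSet, Set.mem_ofPred_eq, not_not, Sum.elim_comp_map, Function.comp_id,
    Sum.elim_comp_inl, Sum.elim_comp_inr] at h2 h3
  exact h3.2 (h2.1 h1)

end Sys
end

section
namespace VC
open Finset

def NoShat {Y : Type*} {Z : Type*} (d : ℕ) (ρ : Y → Z → Prop) : Prop :=
  ¬ ∃ a : Fin d → Y, ∀ X : Set (Fin d), ∃ z, ∀ i, ρ (a i) z ↔ i ∈ X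

theorem card_small {P : Type*} [Fintype P] [DecidableEq P] (d : ℕ) (𝒮 : Finset (Finset P))
    (h : ∀ s ∈ 𝒮, #s ≤ d) : #𝒮 ≤ (Fintype.card P + 1) ^ d := by
  classical
  have hsub : 𝒮 ⊆ (univ : Finset (Fin d → Option P)).image
      (fun f => univ.filter fun p => ∃ i, f i = some p) := by
    intro s hs
    rw [mem_image]
    obtain ⟨e⟩ : Nonempty (s ↪ Fin d) := by
      rw [Function.Embedding.nonempty_iff_card_le]
      simpa using h s hs
    refine ⟨fun i => if hi : ∃ p : s, e p = i then some hi.choose else none, mem_univ _, ?_⟩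
    ext p
    simp only [mem_filter, mem_univ, true_and]
    constructor
    · rintro ⟨i, hi⟩
      split_ifs at hi with h1
      · rw [← Option.some_injective _ hi]; exact h1.choose.2
    · intro hp
      refine ⟨e ⟨p, hp⟩, ?_⟩
      have h1 : ∃ q : s, e q = e ⟨p, hp⟩ := ⟨_, rfl⟩
      rw [dif_pos h1]
      have := e.injective h1.choose_spec
      rw [this]
  refine (card_le_card hsub).trans (card_image_le.trans ?_)
  simp

theorem card_traces {Y : Type*} {Z : Type*} {ρ : Y → Z → Prop} {d : ℕ} (hd : NoShat d ρ)
    {P : Type*} [Fintype P] [DecidableEq P] (pts : P → Y) (𝒜 : Finset (Finset P))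
    (h𝒜 : ∀ A ∈ 𝒜, ∃ z, ∀ p, p ∈ A ↔ ρ (pts p) z) : #𝒜 ≤ (Fintype.card P + 1) ^ d := by
  refine (card_le_card_shatterer 𝒜).trans (card_small d _ fun s hs => ?_)
  rw [mem_shatterer] at hs
  by_contra hlt
  push Not at hlt
  obtain ⟨t, hts, htd⟩ := exists_subset_card_eq hlt.le
  have ht := hs.mono_right hts
  classical
  let e : Fin d ≃ t := (t.equivFinOfCardEq htd).symm
  apply hd
  refine ⟨fun i => pts (e i), fun X => ?_⟩
  obtain ⟨u, hu, hu'⟩ := ht (t := t.filter fun p => ∃ i ∈ X, (e i : P) = p) (filter_subset _ _)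
  obtain ⟨z, hz⟩ := h𝒜 u hu
  refine ⟨z, fun i => ?_⟩
  rw [← hz]
  have : (e i : P) ∈ t ∩ u ↔ (e i : P) ∈ t.filter fun p => ∃ i ∈ X, (e i : P) = p := by rw [hu']
  simp only [mem_inter, coe_mem, true_and, mem_filter] at this
  rw [this]
  constructor
  · rintro ⟨j, hj, hij⟩
    rwa [← e.injective (Subtype.ext hij)]
  · intro hi
    exact ⟨i, hi, rfl⟩

theorem exists_m (d : ℕ) : ∃ m : ℕ, ((2 * m + 1 : ℕ) : ℝ) ^ d < (3 / 2 : ℝ) ^ m := by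
  have h := tendsto_pow_const_mul_const_pow_of_abs_lt_one d (r := (2 / 3 : ℝ))
    (by rw [abs_lt]; constructor <;> norm_num)
  have h2 := h.const_mul ((3 : ℝ) ^ d)
  rw [mul_zero] at h2
  obtain ⟨m, hm1, hm⟩ := ((h2.eventually (gt_mem_nhds (show (0 : ℝ) < 1 by norm_num))).and
    (Filter.eventually_ge_atTop 1)).exists
  refine ⟨m, ?_⟩
  have h3 : ((2 * m + 1 : ℕ) : ℝ) ^ d ≤ (3 : ℝ) ^ d * (m : ℝ) ^ d := by
    rw [← mul_pow]
    have : (1 : ℝ) ≤ m := by exact_mod_cast hm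
    push_cast
    gcongr
    linarith
  refine h3.trans_lt ?_
  have h4 : (2 / 3 : ℝ) ^ m * (3 / 2 : ℝ) ^ m = 1 := by
    rw [← mul_pow]; norm_num
  have h5 : (0 : ℝ) < (3 / 2 : ℝ) ^ m := by positivity
  calc (3 : ℝ) ^ d * (m : ℝ) ^ d = (3 ^ d * (m ^ d * (2 / 3) ^ m)) * (3 / 2) ^ m := by
        rw [mul_assoc, mul_assoc, h4]; ring
    _ < 1 * (3 / 2) ^ m := by gcongr
    _ = _ := one_mul _

/-- payoff -/
def pay (a : Bool × Bool) : ℝ := if a.1 then 0 else if a.2 then 2 else 1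

def swp {A : Type*} {m : ℕ} (σ : Fin m → Bool) (h : Fin m → A × A) : Fin m → A × A :=
  fun i => if σ i then (h i).swap else h i

theorem swp_inv {A : Type*} {m : ℕ} (σ : Fin m → Bool) :
    Function.Involutive (swp σ : (Fin m → A × A) → _) := by
  intro h
  funext i
  simp only [swp]
  split_ifs <;> simp

theorem net {Y : Type*} {Z : Type*} {ρ : Y → Z → Prop} {d : ℕ} (hd : NoShat d ρ) {m : ℕ}
    (hm : ((2 * m + 1 : ℕ) : ℝ) ^ d < (3 / 2 : ℝ) ^ m) {P : Type*} [Fintype P]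
    (pts : P → Y) (μ : P → ℝ) (hμ : ∀ p, 0 ≤ μ p) (hμ1 : ∑ p, μ p = 1) {κ : Type*} (zs : κ → Z)
    (hz : ∀ k, (1 / 2 : ℝ) ≤ ∑ p, μ p * (open Classical in if ρ (pts p) (zs k) then 1 else 0)) :
    ∃ f : Fin m → P, ∀ k, ∃ i, ρ (pts (f i)) (zs k) := by
  classical
  by_contra hcon
  push Not at hcon
  choose kk hkk using hcon
  let H := Fin m → P × P
  let W : H → ℝ := fun h => ∏ i, (μ (h i).1 * μ (h i).2)
  let Tr : H → (Fin m → Bool × Bool) → Prop := fun h A => ∃ z, ∀ i,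
    A i = (decide (ρ (pts (h i).1) z), decide (ρ (pts (h i).2) z))
  let Ψ : H → ℝ := fun h => ∑ A, if Tr h A then ∏ i, pay (A i) else 0
  have hW : ∀ h, 0 ≤ W h := fun h => prod_nonneg fun i _ => mul_nonneg (hμ _) (hμ _)
  have hpay : ∀ a, 0 ≤ pay a := by
    intro a; unfold pay; split_ifs <;> norm_num
  have hW1 : ∑ h, W h = 1 := by
    have := Fintype.prod_sum (κ := fun _ : Fin m => P × P) (fun (i : Fin m) (q : P × P) => μ q.1 * μ q.2)
    rw [show ∑ h, W h = ∑ h : Fin m → P × P, ∏ i, (μ (h i).1 * μ (h i).2) from rfl, ← this]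
    apply prod_eq_one
    intro i _
    rw [Fintype.sum_prod_type]
    simp only [← mul_sum, hμ1, mul_one]
  have hTr : ∀ h, (#(univ.filter (Tr h)) : ℝ) ≤ ((2 * m + 1 : ℕ) : ℝ) ^ d := by
    intro h
    let em : (Fin m → Bool × Bool) → Finset (Fin m ⊕ Fin m) := fun A =>
      univ.filter fun x => Sum.elim (fun i => (A i).1 = true) (fun i => (A i).2 = true) x
    have hem : Function.Injective em := by
      intro A B hAB
      funext i
      have h1 : Sum.inl i ∈ em A ↔ Sum.inl i ∈ em B := by rw [hAB]
      have h2 : Sum.inr i ∈ em A ↔ Sum.inr i ∈ em B := by rw [hAB]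
      simp only [em, mem_filter, mem_univ, true_and, Sum.elim_inl, Sum.elim_inr] at h1 h2
      ext
      · exact Bool.eq_iff_iff.2 h1
      · exact Bool.eq_iff_iff.2 h2
    have := card_traces hd (P := Fin m ⊕ Fin m)
      (Sum.elim (fun i => pts (h i).1) (fun i => pts (h i).2)) ((univ.filter (Tr h)).image em) (by
        intro A hA
        obtain ⟨B, hB, rfl⟩ := mem_image.1 hA
        obtain ⟨z, hz⟩ := (mem_filter.1 hB).2
        refine ⟨z, ?_⟩
        rintro (i | i) <;> simp [em, hz])
    rw [card_image_of_injective _ hem] at this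
    simp only [Fintype.card_sum, Fintype.card_fin] at this
    rw [two_mul]
    exact_mod_cast this
  -- symmetrization
  have hsym : ∀ σ : Fin m → Bool, ∑ h, W h * Ψ h =
      ∑ h, W h * ∑ A, if Tr h A then ∏ i, pay (swp σ A i) else 0 := by
    intro σ
    rw [← Equiv.sum_comp (Function.Involutive.toPerm _ (swp_inv (A := P) σ))]
    refine sum_congr rfl fun h _ => ?_
    have e1 : W (swp σ h) = W h := by
      refine prod_congr rfl fun i _ => ?_
      simp only [swp]
      split_ifs
      · simp [mul_comm]
      · rfl
    have e2 : Ψ (swp σ h) = ∑ A, if Tr h A then ∏ i, pay (swp σ A i) else 0 := by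
      simp only [Ψ]
      rw [← Equiv.sum_comp (Function.Involutive.toPerm _ (swp_inv (A := Bool) σ))]
      refine sum_congr rfl fun A _ => ?_
      have : Tr (swp σ h) (swp σ A) ↔ Tr h A := by
        refine exists_congr fun z => forall_congr' fun i => ?_
        simp only [swp]
        split_ifs
        · simp only [Prod.fst_swap, Prod.snd_swap]
          rw [← Prod.swap_inj]; simp
        · rfl
      simp only [Function.Involutive.coe_toPerm, this]
    simp only [Function.Involutive.coe_toPerm, e1, e2]
  have hup : (2 : ℝ) ^ m * ∑ h, W h * Ψ h ≤ 2 ^ m * ((2 * m + 1 : ℕ) : ℝ) ^ d := by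
    have e1 : (2 : ℝ) ^ m * ∑ h, W h * Ψ h = ∑ σ : Fin m → Bool, ∑ h, W h * Ψ h := by
      simp
    rw [e1, sum_congr rfl fun σ _ => hsym σ, sum_comm]
    calc ∑ h, ∑ σ : Fin m → Bool, W h * ∑ A, (if Tr h A then ∏ i, pay (swp σ A i) else 0)
        ≤ ∑ h, W h * (2 ^ m * ((2 * m + 1 : ℕ) : ℝ) ^ d) := by
          refine sum_le_sum fun h _ => ?_
          rw [← mul_sum]
          refine mul_le_mul_of_nonneg_left ?_ (hW h)
          rw [sum_comm]
          have : ∀ A : Fin m → Bool × Bool,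
              ∑ σ : Fin m → Bool, (if Tr h A then ∏ i, pay (swp σ A i) else 0) ≤
              if Tr h A then (2 : ℝ) ^ m else 0 := by
            intro A
            split_ifs
            · have e := Fintype.prod_sum (κ := fun _ : Fin m => Bool)
                (fun (i : Fin m) (s : Bool) => pay (if s then (A i).swap else A i))
              have e' : ∑ σ : Fin m → Bool, ∏ i, pay (swp σ A i) =
                ∑ σ : Fin m → Bool, ∏ i, pay (if σ i then (A i).swap else A i) := rfl
              rw [e', ← e]
              calc ∏ i : Fin m, ∑ s : Bool, pay (if s then (A i).swap else A i)
                  ≤ ∏ i : Fin m, (2 : ℝ) := by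
                    refine prod_le_prod (fun i _ => sum_nonneg fun _ _ => hpay _) fun i _ => ?_
                    rcases A i with ⟨_ | _, _ | _⟩ <;> simp [pay] <;> norm_num
                _ = 2 ^ m := by simp
            · simp
          refine (sum_le_sum fun A _ => this A).trans ?_
          rw [← sum_filter, sum_const, nsmul_eq_mul, mul_comm]
          exact mul_le_mul_of_nonneg_left (hTr h) (by positivity)
      _ = _ := by rw [← sum_mul, hW1, one_mul]
  have hlow : (3 / 2 : ℝ) ^ m ≤ ∑ h, W h * Ψ h := by
    have hΨ : ∀ f g : Fin m → P, ∏ i, (1 + if ρ (pts (g i)) (zs (kk f)) then (1 : ℝ) else 0) ≤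
        Ψ (fun i => (f i, g i)) := by
      intro f g
      let A : Fin m → Bool × Bool := fun i =>
        (decide (ρ (pts (f i)) (zs (kk f))), decide (ρ (pts (g i)) (zs (kk f))))
      have h1 : Tr (fun i => (f i, g i)) A := ⟨zs (kk f), fun i => rfl⟩
      have h2 := single_le_sum (s := univ)
        (f := fun A => if Tr (fun i => (f i, g i)) A then ∏ i, pay (A i) else 0)
        (fun A _ => by
          split_ifs
          · exact prod_nonneg fun i _ => hpay _
          · exact le_rfl) (mem_univ A)
      rw [if_pos h1] at h2
      refine le_trans (le_of_eq ?_) h2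
      refine prod_congr rfl fun i _ => ?_
      simp only [A, pay, hkk f i, decide_false]
      split_ifs with h3 h4 <;> simp_all <;> norm_num
    have e0 : ∑ h, W h * Ψ h = ∑ f : Fin m → P, ∑ g : Fin m → P,
        ((∏ i, μ (f i)) * (∏ i, μ (g i))) * Ψ (fun i => (f i, g i)) := by
      rw [← Fintype.sum_prod_type' (f := fun (f g : Fin m → P) =>
        ((∏ i, μ (f i)) * (∏ i, μ (g i))) * Ψ (fun i => (f i, g i)))]
      rw [← Equiv.sum_comp (Equiv.arrowProdEquivProdArrow (Fin m) (fun _ => P) (fun _ => P)).symm]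
      refine sum_congr rfl fun h _ => ?_
      simp only [W, prod_mul_distrib]
      rfl
    rw [e0]
    have e2 : ∀ f : Fin m → P, (∏ i, μ (f i)) * (3 / 2 : ℝ) ^ m ≤ ∑ g : Fin m → P,
        ((∏ i, μ (f i)) * (∏ i, μ (g i))) * Ψ (fun i => (f i, g i)) := by
      intro f
      have hf : 0 ≤ ∏ i, μ (f i) := prod_nonneg fun i _ => hμ _
      simp only [mul_assoc]
      rw [← mul_sum]
      refine mul_le_mul_of_nonneg_left ?_ hf
      have e3 : (3 / 2 : ℝ) ^ m ≤ ∑ g : Fin m → P, ∏ i, (μ (g i) *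
          (1 + if ρ (pts (g i)) (zs (kk f)) then (1 : ℝ) else 0)) := by
        have e := Fintype.prod_sum (κ := fun _ : Fin m => P)
          (fun (i : Fin m) (p : P) => μ p * (1 + if ρ (pts p) (zs (kk f)) then (1 : ℝ) else 0))
        rw [← e]
        have : ∀ i : Fin m, (3 / 2 : ℝ) ≤
            ∑ p, μ p * (1 + if ρ (pts p) (zs (kk f)) then (1 : ℝ) else 0) := by
          intro i
          simp only [mul_add, mul_one, sum_add_distrib, hμ1]
          have := hz (kk f)
          linarith
        calc (3 / 2 : ℝ) ^ m = ∏ i : Fin m, (3 / 2 : ℝ) := by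
              rw [prod_const, card_univ, Fintype.card_fin]
          _ ≤ _ := prod_le_prod (fun _ _ => by norm_num) fun i _ => this i
      refine e3.trans (sum_le_sum fun g _ => ?_)
      rw [prod_mul_distrib]
      exact mul_le_mul_of_nonneg_left (hΨ f g) (prod_nonneg fun i _ => hμ _)
    refine le_trans (le_of_eq ?_) (sum_le_sum fun f _ => e2 f)
    rw [← sum_mul]
    have e := Fintype.prod_sum (κ := fun _ : Fin m => P) (fun (i : Fin m) (p : P) => μ p)
    rw [← e]
    simp [hμ1]
  have h2 : (0 : ℝ) < 2 ^ m := by positivity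
  have := le_of_mul_le_mul_left hup h2
  linarith

/-- minimax for 0/1 matrices -/
theorem minimax {I J : Type} [Fintype I] [Fintype J] [Nonempty I] [Nonempty J] (K : I → J → ℝ) :
    (∃ μ ∈ stdSimplex ℝ J, ∀ i, (1 / 2 : ℝ) ≤ ∑ j, μ j * K i j) ∨
    (∃ ν ∈ stdSimplex ℝ I, ∀ j, ∑ i, ν i * K i j ≤ (1 / 2 : ℝ)) := by
  classical
  have hne : ∀ (A : Type) [Fintype A] [Nonempty A], (stdSimplex ℝ A).Nonempty := fun A _ _ =>
    ⟨_, single_mem_stdSimplex ℝ (Classical.arbitrary A)⟩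
  let f : (I → ℝ) → (J → ℝ) → ℝ := fun ν μ => ∑ i, ∑ j, ν i * μ j * K i j
  have hlin1 : ∀ y : J → ℝ, ∀ x x' : I → ℝ, ∀ a c : ℝ,
      f (a • x + c • x') y = a * f x y + c * f x' y := by
    intro y x x' a c
    simp only [f, mul_sum, ← sum_add_distrib, Pi.add_apply, Pi.smul_apply, smul_eq_mul]
    refine sum_congr rfl fun i _ => sum_congr rfl fun j _ => ?_
    ring
  have hlin2 : ∀ x : I → ℝ, ∀ y y' : J → ℝ, ∀ a c : ℝ,
      f x (a • y + c • y') = a * f x y + c * f x y' := by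
    intro x y y' a c
    simp only [f, mul_sum, ← sum_add_distrib, Pi.add_apply, Pi.smul_apply, smul_eq_mul]
    refine sum_congr rfl fun i _ => sum_congr rfl fun j _ => ?_
    ring
  obtain ⟨ν, hν, μ, hμ, hs⟩ := Sion.exists_isSaddlePointOn (f := f) (hne I)
    (convex_stdSimplex ℝ I) (isCompact_stdSimplex ℝ I)
    (fun y _ => Continuous.lowerSemicontinuous (by fun_prop) |>.lowerSemicontinuousOn _)
    (fun y _ => ConvexOn.quasiconvexOn (𝕜 := ℝ) ⟨convex_stdSimplex ℝ I,
      fun x _ x' _ a c _ _ _ => le_of_eq (hlin1 y x x' a c)⟩)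
    (convex_stdSimplex ℝ J) (hne J) (isCompact_stdSimplex ℝ J)
    (fun y _ => Continuous.upperSemicontinuous (by fun_prop) |>.upperSemicontinuousOn _)
    (fun x _ => ConcaveOn.quasiconcaveOn (𝕜 := ℝ) ⟨convex_stdSimplex ℝ J,
      fun y _ y' _ a c _ _ _ => ge_of_eq (hlin2 x y y' a c)⟩)
  have hs' : ∀ x ∈ stdSimplex ℝ I, ∀ y ∈ stdSimplex ℝ J, f ν y ≤ f x μ := hs
  have e1 : ∀ i, f (Pi.single i 1) μ = ∑ j, μ j * K i j := by
    intro i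
    simp only [f]
    rw [sum_eq_single i]
    · simp
    · intro k _ hk; simp [Pi.single_eq_of_ne hk]
    · simp
  have e2 : ∀ j, f ν (Pi.single j 1) = ∑ i, ν i * K i j := by
    intro j
    simp only [f]
    refine sum_congr rfl fun i _ => ?_
    rw [sum_eq_single j]
    · simp
    · intro k _ hk; simp [Pi.single_eq_of_ne hk]
    · simp
  rcases le_total (1 / 2 : ℝ) (f ν μ) with h | h
  · left
    refine ⟨μ, hμ, fun i => ?_⟩
    rw [← e1]
    exact h.trans (hs' _ (single_mem_stdSimplex ℝ i) _ hμ)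
  · right
    refine ⟨ν, hν, fun j => ?_⟩
    rw [← e2]
    exact (hs' _ hν _ (single_mem_stdSimplex ℝ j)).trans h

theorem NoShat.not {Y Z : Type*} {d : ℕ} {ρ : Y → Z → Prop} (h : NoShat d ρ) :
    NoShat d (fun y z => ¬ ρ y z) := by
  rintro ⟨a, ha⟩
  refine h ⟨a, fun X => ?_⟩
  obtain ⟨z, hz⟩ := ha Xᶜ
  refine ⟨z, fun i => ?_⟩
  have := hz i
  simp only [Set.mem_compl_iff] at this
  exact not_iff_not.1 this

/-- the `(p,q)`-type covering lemma -/
theorem cover {Y Z : Type*} {d : ℕ} {ρ : Y → Z → Prop} (h : NoShat d ρ)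
    (h' : NoShat d (fun z y => ρ y z)) :
    ∃ s : ℕ, ∀ (k : ℕ) (B : Fin k → Y) (Z' : Set Z), Z'.Nonempty →
      (∀ f : Fin s → Fin k, ∃ z ∈ Z', ∀ i, ρ (B (f i)) z) →
      ∃ g : Fin s → Z, (∀ i, g i ∈ Z' ) ∧ ∀ y, ∃ i, ρ (B y) (g i) := by
  classical
  obtain ⟨m, hm⟩ := exists_m d
  refine ⟨m, fun k B Z' hZ hB => ?_⟩
  rcases Nat.eq_zero_or_pos k with rfl | hk
  · obtain ⟨z, hz⟩ := hZ
    exact ⟨fun _ => z, fun _ => hz, fun y => y.elim0⟩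
  choose zz hzz hρ using hB
  have : Nonempty (Fin k) := ⟨⟨0, hk⟩⟩
  let K : Fin k → (Fin m → Fin k) → ℝ := fun y f => if ρ (B y) (zz f) then 1 else 0
  rcases minimax K with ⟨μ, hμ, H⟩ | ⟨ν, hν, H⟩
  · obtain ⟨f, hf⟩ := net h' hm zz μ hμ.1 hμ.2 B H
    exact ⟨fun i => zz (f i), fun i => hzz _, hf⟩
  · exfalso
    obtain ⟨f, hf⟩ := net h.not hm B ν hν.1 hν.2 zz (by
      intro f
      refine le_of_le_of_eq (b := 1 - ∑ y, ν y * K y f) (by linarith [H f]) ?_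
      rw [show (1 : ℝ) - ∑ y, ν y * K y f = ∑ y, (ν y - ν y * K y f) by
        rw [sum_sub_distrib, hν.2] ]
      refine sum_congr rfl fun y _ => ?_
      by_cases hh : ρ (B y) (zz f) <;> simp [K, hh])
    obtain ⟨i, hi⟩ := hf f
    exact hi (hρ f i)

end VC
end

section
namespace Sys
open Filter
variable {U : Type w} {T : Sys U}

theorem exists_strict {γ : Type} [Finite γ] (b : γ → U) :
    ∃ q : T.InvType γ, q.Rel (Empty.elim : Empty → U) b ∧
      ∀ {β : Type} [Finite β] (h : β → U) (e : γ → U), q.Rel h e →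
        ∃ R : T.InvType β, R.Rel e h := by
  obtain ⟨𝒰, hI, h𝒰⟩ := exists_inv (T := T) (γ := γ)
    (fun {β} ψ c => T.Def ψ ∧ ∀ m : β → U, (∀ i, m i ∈ T.M) → Sum.elim b m ∉ ψ)
    (fun h => h.1)
    (fun _ h => h)
    (by
      intro β β' _ _ ψ c ψ' c' h h'
      refine ⟨pun_def h.1 h'.1, fun m hm hmem => ?_⟩
      have : m = Sum.elim (m ∘ Sum.inl) (m ∘ Sum.inr) := by simp
      rw [this, mem_pun] at hmem
      rcases hmem with h1 | h1
      · exact h.2 _ (fun i => hm _) h1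
      · exact h'.2 _ (fun i => hm _) h1)
    ⟨Def_empty, fun _ _ h => h⟩
    (by
      intro β F _ _ ψ e he
      by_contra hcon
      push Not at hcon
      rcases isEmpty_or_nonempty F with hF | ⟨⟨f0⟩⟩
      · obtain ⟨f, _⟩ := hcon b
        exact hF.elim f
      have hψ := (he f0).1
      have hD : T.Def {v : F × β → U | ∀ y : γ → U, Sum.elim y v ∈
          {u : γ ⊕ (F × β) → U | ∃ f, u ∘ Sum.map id (fun i => (f, i)) ∈ ψ}} :=
        Def_forall (Def_iUnion (S := fun f => {u : γ ⊕ (F × β) → U |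
          u ∘ Sum.map id (fun i => (f, i)) ∈ ψ}) fun f => T.pre _ hψ)
      obtain ⟨m, hm, hmM⟩ := T.tv hD ⟨fun p => e p.1 p.2, fun y => by
        obtain ⟨f, hf⟩ := hcon y
        refine ⟨f, mcong' hf ?_⟩
        rintro (x | x) <;> rfl⟩
      obtain ⟨f, hf⟩ := hm b
      refine (he f).2 (fun i => m (f, i)) (fun i => hmM _) (mcong' hf ?_)
      rintro (x | x) <;> rfl)
  refine ⟨ofUltra 𝒰 hI, ?_, ?_⟩
  · refine uRel_empty _ fun S hS hb => ?_
    have := h𝒰 (β := Empty) {v | v ∘ Sum.inl ∈ Sᶜ} Empty.elim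
      ⟨T.pre _ (T.compl hS), fun m _ h => h (by simpa using hb)⟩
    filter_upwards [this] with y hy
    by_contra h2
    exact hy (by simpa using h2)
  · intro β _ h e he
    have heb : T.uRel 𝒰 (Empty.elim : Empty → U) b := by
      refine uRel_empty _ fun S hS hb => ?_
      have := h𝒰 (β := Empty) {v | v ∘ Sum.inl ∈ Sᶜ} Empty.elim
        ⟨T.pre _ (T.compl hS), fun m _ h => h (by simpa using hb)⟩
      filter_upwards [this] with y hy
      by_contra h2
      exact hy (by simpa using h2)
    have hee : T.eqv b e := ((ofUltra 𝒰 hI).inv (eqv.refl _) heb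
      ((ofUltra 𝒰 hI).mono' (β' := Empty) he Empty.elim (g := Empty.elim)
        (fun i => i.elim))).of Sum.inl (fun _ => rfl) (fun _ => rfl)
    obtain ⟨𝒱, hC, h𝒱⟩ := exists_conc (T := T) (γ := β)
      {B | ∃ S : Set (γ ⊕ β → U), T.Def S ∧ Sum.elim e h ∈ S ∧ B = {v | Sum.elim e v ∈ S}}
      ⟨_, Set.univ, T.univ, trivial, rfl⟩
      (by
        rintro _ ⟨S, h1, h2, rfl⟩ _ ⟨S', h1', h2', rfl⟩
        exact ⟨_, ⟨S ∩ S', T.inter h1 h1', ⟨h2, h2'⟩, rfl⟩, fun v hv => hv⟩)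
      (by
        rintro _ ⟨S, h1, h2, rfl⟩
        have : ∃ m : β → U, (∀ i, m i ∈ T.M) ∧ Sum.elim b m ∈ S := by
          by_contra hcon
          push Not at hcon
          exact ((he S h1).1 h2 |>.and (h𝒰 S h ⟨h1, hcon⟩)).exists.elim fun y hy => hy.2 hy.1
        obtain ⟨m, hm, hS⟩ := this
        refine ⟨m, ?_, hm⟩
        have hD := T.fiber (Def_pre (S' := {v : β ⊕ γ → U | v ∘ Sum.swap ∈ S}) h1 Sum.swap
          (fun _ => Iff.rfl)) m hm
        have h3 : Sum.elim m e ∘ Sum.swap ∈ S := (hee _ hD).1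
          (show Sum.elim m b ∘ Sum.swap ∈ S from mcong' hS (by rintro (x | x) <;> rfl))
        exact show Sum.elim e m ∈ S from mcong' h3 (by rintro (x | x) <;> rfl))
    refine ⟨ofUltra 𝒱 hC.inv, uRel_mem fun S hS hev => ?_⟩
    by_contra hcon
    have := h𝒱 _ ⟨{v : γ ⊕ β → U | v ∘ Sum.swap ∈ Sᶜ}, T.pre _ (T.compl hS),
      fun h1 => hcon (mcong' h1 (by rintro (x | x) <;> rfl)), rfl⟩
    obtain ⟨y, h1, h2⟩ := (hev.and this).exists
    exact h2 (mcong' h1 (by rintro (x | x) <;> rfl))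

variable (T) in
def Free {α γ : Type} (φ : Set (α ⊕ γ → U)) (b : γ → U) : Prop :=
  ∀ (F : Type) [Finite F] (d : F → γ → U), (∀ f, T.eqv b (d f)) → ∃ x : α → U, ∀ f, Sum.elim x (d f) ∈ φ

theorem exists_free {α γ : Type} [Finite α] [Finite γ] {φ : Set (α ⊕ γ → U)} (hφ : T.Def φ)
    {b : γ → U} (hf : T.Free φ b) :
    ∃ q : T.InvType α, ∀ b' x, T.eqv b b' → q.Rel b' x → Sum.elim x b' ∈ φ := by
  obtain ⟨𝒰, hI, h𝒰⟩ := exists_inv (T := T) (γ := α)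
    (fun {β} ψ c => T.Def ψ ∧ ∀ c', T.eqv c c' → ∃ (F : Type) (_ : Finite F) (d : F → γ → U),
      (∀ f, T.eqv b (d f)) ∧ ∀ x : α → U, Sum.elim x c' ∈ ψ → ∃ f, Sum.elim x (d f) ∉ φ)
    (fun h => h.1)
    (fun e h => ⟨h.1, fun c' hc' => h.2 c' (e.trans hc')⟩)
    (by
      intro β β' _ _ ψ c ψ' c' h h'
      refine ⟨pun_def h.1 h'.1, fun c1 hc1 => ?_⟩
      obtain ⟨F, _, d, h1, h2⟩ := h.2 (c1 ∘ Sum.inl) (hc1.of Sum.inl (fun _ => rfl) (fun _ => rfl))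
      obtain ⟨F', _, d', h1', h2'⟩ := h'.2 (c1 ∘ Sum.inr)
        (hc1.of Sum.inr (fun _ => rfl) (fun _ => rfl))
      refine ⟨F ⊕ F', inferInstance, Sum.elim d d', ?_, fun x hx => ?_⟩
      · rintro (f | f)
        · exact h1 f
        · exact h1' f
      · rw [show c1 = Sum.elim (c1 ∘ Sum.inl) (c1 ∘ Sum.inr) by simp, mem_pun] at hx
        rcases hx with hx | hx
        · obtain ⟨f, hf⟩ := h2 x hx
          exact ⟨Sum.inl f, hf⟩
        · obtain ⟨f, hf⟩ := h2' x hx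
          exact ⟨Sum.inr f, hf⟩)
    ⟨Def_empty, fun _ _ => ⟨Empty, inferInstance, fun f => f.elim, fun f => f.elim,
      fun _ h => h.elim⟩⟩
    (by
      intro β F _ _ ψ e he
      choose G hG d h1 h2 using fun f => (he f).2 (e f) (eqv.refl _)
      obtain ⟨x, hx⟩ := hf (Σ f, G f) (fun p => d p.1 p.2) (fun p => h1 _ _)
      refine ⟨x, fun f hmem => ?_⟩
      obtain ⟨g, hg⟩ := h2 f x hmem
      exact hg (hx ⟨f, g⟩))
  refine ⟨ofUltra 𝒰 hI, fun b' x e hx => ?_⟩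
  refine (hx φ hφ).2 ?_
  have := h𝒰 φᶜ b' ⟨T.compl hφ, fun c' hc' => ⟨Unit, inferInstance, fun _ => c',
    fun _ => e.trans hc', fun x hx => ⟨(), hx⟩⟩⟩
  filter_upwards [this] with y hy
  by_contra h
  exact hy h

end Sys
end

section
namespace VC

theorem NoShat.mono {Y Z : Type*} {d d' : ℕ} (hdd : d ≤ d') {ρ : Y → Z → Prop} (h : NoShat d ρ) :
    NoShat d' ρ := by
  rintro ⟨a, ha⟩
  refine h ⟨fun i => a (Fin.castLE hdd i), fun X => ?_⟩
  obtain ⟨z, hz⟩ := ha (Fin.castLE hdd '' X)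
  refine ⟨z, fun i => ?_⟩
  rw [hz, (Fin.castLE_injective hdd).mem_set_image]

theorem exists_n (D t : ℕ) (ht : 0 < t) : ∃ n : ℕ, (n * t + 1) ^ D * (t - 1) ^ n < t ^ n := by
  have ht' : (0 : ℝ) < t := by exact_mod_cast ht
  have ht1 : ((t - 1 : ℕ) : ℝ) = t - 1 := by rw [Nat.cast_sub ht]; simp
  have h := tendsto_pow_const_mul_const_pow_of_abs_lt_one D (r := ((t - 1 : ℕ) : ℝ) / t)
    (by
      rw [abs_of_nonneg (by positivity), div_lt_one ht', ht1]; linarith)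
  have h2 := h.const_mul (((t + 1 : ℕ) : ℝ) ^ D)
  rw [mul_zero] at h2
  obtain ⟨m, hm1, hm⟩ := ((h2.eventually (gt_mem_nhds (show (0 : ℝ) < 1 by norm_num))).and
    (Filter.eventually_ge_atTop 1)).exists
  refine ⟨m, ?_⟩
  have h3 : (m * t + 1) ^ D ≤ (t + 1) ^ D * m ^ D := by
    rw [← mul_pow]
    gcongr
    nlinarith
  have h4 : (((t + 1) ^ D * m ^ D * (t - 1) ^ m : ℕ) : ℝ) < ((t ^ m : ℕ) : ℝ) := by
    have h5 : (0 : ℝ) < (t : ℝ) ^ m := by positivity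
    have := mul_lt_mul_of_pos_right hm1 h5
    rw [one_mul, div_pow] at this
    push_cast at this ⊢
    refine lt_of_eq_of_lt ?_ this
    field_simp
  calc _ ≤ (t + 1) ^ D * m ^ D * (t - 1) ^ m := Nat.mul_le_mul_right _ h3
    _ < _ := by exact_mod_cast h4

open Finset in
/-- the path-counting argument -/
theorem path_count {Y Z : Type*} {ρ : Y → Z → Prop} {D : ℕ} (hD : NoShat D ρ) {F : Type*} [Fintype F]
    (hF : 0 < Fintype.card F)
    (E : ∀ n : ℕ, ∃ E : ℕ → F → Y, (∀ p : ℕ → F, ∃ z, ∀ j < n, ρ (E j (p j)) z) ∧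
      ∀ j < n, ∀ z, ∃ f, ¬ ρ (E j f) z) : False := by
  classical
  obtain ⟨n, hn⟩ := exists_n D (Fintype.card F) hF
  obtain ⟨E, h1, h2⟩ := E n
  obtain ⟨f0⟩ : Nonempty F := Fintype.card_pos_iff.1 hF
  have h1' : ∀ p : Fin n → F, ∃ z, ∀ j : Fin n, ρ (E j (p j)) z := by
    intro p
    obtain ⟨z, hz⟩ := h1 (fun j => if hj : j < n then p ⟨j, hj⟩ else f0)
    refine ⟨z, fun j => ?_⟩
    have := hz j j.2
    simpa using this
  choose z hz using h1'
  let tr : Z → Finset (Fin n × F) := fun z => univ.filter fun q => ρ (E q.1 q.2) z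
  let 𝒜 : Finset (Finset (Fin n × F)) := univ.image fun p => tr (z p)
  have hA : #𝒜 ≤ (n * Fintype.card F + 1) ^ D := by
    have := card_traces hD (P := Fin n × F) (fun q => E q.1 q.2) 𝒜 (by
      intro A hA
      obtain ⟨p, -, rfl⟩ := mem_image.1 hA
      exact ⟨z p, fun q => by simp [tr]⟩)
    simpa using this
  have hcov : (univ : Finset (Fin n → F)) ⊆ 𝒜.biUnion fun A =>
      Fintype.piFinset fun j => univ.filter fun f => (j, f) ∈ A := by
    intro p _
    rw [mem_biUnion]
    refine ⟨tr (z p), mem_image_of_mem _ (mem_univ _), ?_⟩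
    rw [Fintype.mem_piFinset]
    intro j
    simpa [tr] using hz p j
  have h3 := (card_le_card hcov).trans (card_biUnion_le_card_mul _ _ ((Fintype.card F - 1) ^ n) (by
    intro A hA
    obtain ⟨p, -, rfl⟩ := mem_image.1 hA
    rw [Fintype.card_piFinset]
    calc _ ≤ ∏ _j : Fin n, (Fintype.card F - 1) := by
          refine prod_le_prod' fun j _ => ?_
          obtain ⟨f, hf⟩ := h2 j j.2 (z p)
          have : (univ.filter fun f => (j, f) ∈ tr (z p)) ⊆ univ.erase f := by
            intro f' hf'
            rw [mem_erase]
            refine ⟨?_, mem_univ _⟩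
            rintro rfl
            simp [tr] at hf'
            exact hf hf'
          refine (card_le_card this).trans ?_
          rw [card_erase_of_mem (mem_univ _), card_univ]
      _ = _ := by simp))
  rw [card_univ, Fintype.card_pi_const] at h3
  have := h3.trans (Nat.mul_le_mul_right _ hA)
  omega

end VC

namespace Sys
open Filter VC
variable {U : Type w} {T : Sys U}

theorem noShat {α β : Type} [Finite α] [Finite β] {S : Set (α ⊕ β → U)} (hS : T.Def S) :
    ∃ d, NoShat d (fun (a : α → U) (b : β → U) => Sum.elim a b ∈ S) ∧
      NoShat d (fun (b : β → U) (a : α → U) => Sum.elim a b ∈ S) := by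
  obtain ⟨d, hd⟩ := T.nip hS
  obtain ⟨d', hd'⟩ := T.nip (Def_pre (S' := {v : β ⊕ α → U | v ∘ Sum.swap ∈ S}) hS Sum.swap
          (fun _ => Iff.rfl))
  refine ⟨max d d', NoShat.mono (le_max_left _ _) ?_, NoShat.mono (le_max_right _ _) ?_⟩
  · rintro ⟨a, ha⟩
    choose z hz using ha
    exact hd ⟨a, z, fun i X => hz X i⟩
  · rintro ⟨a, ha⟩
    choose z hz using ha
    refine hd' ⟨a, z, fun i X => ?_⟩
    rw [← hz X i]
    exact mcong (S := S) (by rintro (x | x) <;> rfl)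

def tup {γ I : Type} {m : ℕ} (g : I → γ → U) (i : Fin m → I) : Fin m × γ → U :=
  fun p => g (i p.1) p.2

theorem Morley.indisc {ζ β : Type} [Finite ζ] [Finite β] {Q : T.InvType ζ} {h : β → U}
    {g : ℕ → ζ → U} {k m : ℕ} (H : Morley Q h g k) {i j : Fin m → ℕ} (hi : StrictMono i)
    (hj : StrictMono j) (hik : ∀ l, i l < k) (hjk : ∀ l, j l < k) :
    T.eqv (Sum.elim (tup g i) h) (Sum.elim (tup g j) h) := by
  have key : ∀ i : Fin m → ℕ, StrictMono i → (∀ l, i l < k) →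
      ∃ σ : ℕ → ℕ, (∀ l : Fin m, σ l = i l) ∧ Morley Q h (g ∘ σ) m := by
    intro i hi hik
    refine ⟨fun l => if hl : l < m then i ⟨l, hl⟩ else 0, fun l => by simp, ?_⟩
    refine H.sub _ ?_ ?_ ?_
    · intro l hl; simp [hl, hik]
    · intro l l' hll hl'
      simp only [hl', hll.trans hl', dif_pos]
      exact hi hll
    · intro l hl
      exact ⟨Sum.inr, fun _ => rfl⟩
  obtain ⟨σ, h1, h2⟩ := key i hi hik
  obtain ⟨σ', h1', h2'⟩ := key j hj hjk
  have := Morley.unique (eqv.refl h) m h2 h2'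
  refine this.of id ?_ ?_ <;> rintro (x | x) <;> simp [tup, initSeg, h1, h1']

variable (T) in
def ND {α γ : Type} (φ : Set (α ⊕ γ → U)) (b : γ → U) : Prop :=
  ∀ b' : ℕ → γ → U, (∀ (m : ℕ) (i j : Fin m → ℕ), StrictMono i → StrictMono j →
      T.eqv (tup b' i) (tup b' j)) → T.eqv b (b' 0) →
    ∀ n : ℕ, ∃ x : α → U, ∀ j < n, Sum.elim x (b' j) ∈ φ

theorem consist_def {α γ F : Type} [Finite α] [Finite F] {φ : Set (α ⊕ γ → U)} (hφ : T.Def φ) :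
    T.Def {D : F × γ → U | ∃ x : α → U, ∀ f, Sum.elim x (fun z => D (f, z)) ∈ φ} := by
  have := T.proj (Def_iInter (ι := F) (S := fun f => {u : α ⊕ (F × γ) → U |
          u ∘ Sum.map id (fun i => (f, i)) ∈ φ}) fun f => T.pre _ hφ)
  convert this using 1
  ext D
  refine exists_congr fun x => forall_congr' fun f => mcong (S := φ) ?_
  rintro (x | x) <;> rfl

theorem free_of_nd {α γ : Type} [Finite α] [Finite γ] {φ : Set (α ⊕ γ → U)} (hφ : T.Def φ)
    {b : γ → U} (hND : T.ND φ b) : T.Free φ b := by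
  obtain ⟨q, hqb, hq⟩ := exists_strict (T := T) b
  have hqe : ∀ {β : Type} (h : β → U) (e : γ → U), q.Rel h e → T.eqv b e := fun h e he =>
    (q.inv (eqv.refl _) hqb (q.mono' (β' := Empty) he Empty.elim (g := Empty.elim)
        (fun i => i.elim))).of Sum.inl (fun _ => rfl) (fun _ => rfl)
  have hcons : ∀ n g, Morley q (Empty.elim : Empty → U) g n →
      ∃ x : α → U, ∀ j < n, Sum.elim x (g j) ∈ φ := by
    intro n g hg
    obtain ⟨x, hx⟩ := hND (morleySeq q (Empty.elim : Empty → U))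
      (by
        intro m i j hi hj
        obtain ⟨k, hk⟩ : ∃ k, (∀ l, i l < k) ∧ ∀ l, j l < k := by
          refine ⟨(∑ l, i l) + (∑ l, j l) + 1, fun l => ?_, fun l => ?_⟩
          · have := Finset.single_le_sum (f := i) (fun _ _ => Nat.zero_le _) (Finset.mem_univ l)
            omega
          · have := Finset.single_le_sum (f := j) (fun _ _ => Nat.zero_le _) (Finset.mem_univ l)
            omega
        exact ((morleySeq_spec q _ k).indisc hi hj hk.1 hk.2).of Sum.inl
          (fun _ => rfl) (fun _ => rfl))
      (hqe _ _ (morleySeq_spec q _ 1 0 one_pos)) n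
    have e := (Morley.unique (eqv.refl _) n (morleySeq_spec q (Empty.elim : Empty → U) n) hg).of
      (Sum.inl) (g := initSeg _ n) (g' := initSeg _ n) (fun _ => rfl) (fun _ => rfl)
    obtain ⟨x, hx⟩ := (e _ (consist_def (F := Fin n) hφ)).1 ⟨x, fun j => hx j j.2⟩
    exact ⟨x, fun j hj => hx ⟨j, hj⟩⟩
  intro F hFin d hd
  have := Fintype.ofFinite F
  rcases isEmpty_or_nonempty F with hF | hF
  · obtain ⟨x, _⟩ := hcons 0 (fun _ => b) (fun j hj => by omega)
    exact ⟨x, fun f => hF.elim f⟩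
  obtain ⟨f0⟩ := hF
  by_contra hcon
  push Not at hcon
  let du : F × γ → U := fun p => d p.1 p.2
  have harr : ∀ n, ∃ E : ℕ → F × γ → U, ∀ j < n, T.eqv du (E j) ∧
      ∀ f, q.Rel (initSeg E j) (fun z => E j (f, z)) := by
    intro n
    induction n with
    | zero => exact ⟨fun _ => du, fun j hj => by omega⟩
    | succ n ih =>
      obtain ⟨E, hE⟩ := ih
      obtain ⟨e, he⟩ := q.ex (initSeg E n)
      obtain ⟨R, hR⟩ := hq _ _ he
      obtain ⟨E', hE'⟩ := R.ex du
      have hR' : ∀ f, R.Rel (d f) E' := fun f => R.mono' hE' (fun z => (f, z)) (fun _ => rfl)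
      have heq : ∀ f, T.eqv (Sum.elim (initSeg E n) e) (Sum.elim E' (d f)) := fun f =>
        R.inv ((hqe _ _ he).symm.trans (hd f)) hR (hR' f)
      have hq' : ∀ f, q.Rel E' (d f) := fun f => q.closure he ((heq f).of Sum.swap
        (by rintro (x | x) <;> rfl) (by rintro (x | x) <;> rfl))
      refine ⟨fun j p => if h : j < n then E' (⟨j, h⟩, p) else du p, ?_⟩
      intro j hj
      rcases Nat.lt_or_ge j n with hjn | hjn
      · refine ⟨(hE j hjn).1.trans ?_, fun f => ?_⟩
        · refine (heq f0).of (fun p => Sum.inl (⟨j, hjn⟩, p)) (fun _ => rfl) ?_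
          intro p; simp [hjn]
        · refine q.closure ((hE j hjn).2 f) ((heq f0).of (Sum.elim
            (fun z => Sum.inl (⟨j, hjn⟩, (f, z)))
            (fun p => Sum.inl (⟨p.1, p.1.2.trans hjn⟩, p.2))) ?_ ?_)
          · rintro (x | x) <;> rfl
          · rintro (x | x)
            · simp [hjn]
            · have : x.1.1 < n := x.1.2.trans hjn
              simp [initSeg, this]
      · obtain rfl : j = n := by omega
        refine ⟨?_, fun f => ?_⟩
        · simpa using eqv.refl du
        · have := hq' f
          simp only [lt_irrefl, dif_neg, not_false_eq_true]
          refine q.mono' this id ?_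
          intro p
          simp [initSeg]
  obtain ⟨D, hD, hD'⟩ := noShat hφ
  refine path_count hD' (F := F) (Fintype.card_pos_iff.2 ⟨f0⟩) fun n => ?_
  obtain ⟨E, hE⟩ := harr n
  refine ⟨fun j f z => E j (f, z), fun p => ?_, fun j hj x => ?_⟩
  · refine hcons n (fun j z => E j (p j, z)) fun j hj => ?_
    refine q.mono' ((hE j hj).2 (p j)) (Sum.elim (fun r => (r.1, (p r.1, r.2))) Empty.elim) ?_
    rintro (x | x)
    · rfl
    · exact x.elim
  · by_contra hcon2
    push Not at hcon2
    obtain ⟨y, hy⟩ := ((hE j hj).1 _ (consist_def (F := F) hφ)).2 ⟨x, hcon2⟩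
    obtain ⟨f, hf⟩ := hcon y
    exact hf (hy f)

end Sys
end

section
namespace Sys
open Filter VC
variable {U : Type w} {T : Sys U}

theorem compact_pow {κ : Type} [Finite κ] {s : ℕ} {W : Set (Fin s × κ → U)} (hW : T.Def W)
    (D : κ → U) (h : ∀ e : Fin s × κ → U, (∀ i, T.eqv D (fun z => e (i, z))) → e ∈ W) :
    ∃ σ : Set (κ → U), T.Def σ ∧ D ∈ σ ∧
      ∀ e : Fin s × κ → U, (∀ i, (fun z => e (i, z)) ∈ σ) → e ∈ W := by
  by_contra hcon
  push Not at hcon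
  obtain ⟨e, he⟩ := sat_inter (T := T) (α := Fin s × κ) (β := Empty) Empty.elim
    {S | T.Def S ∧ ∃ σ : Set (κ → U), T.Def σ ∧ D ∈ σ ∧
      ∀ e : Fin s × κ → U, (∀ i, (fun z => e (i, z)) ∈ σ) → e ∉ W → Sum.elim e Empty.elim ∈ S}
    (fun S hS => hS.1) ⟨T.univ, Set.univ, T.univ, trivial, fun _ _ _ => trivial⟩
    (by
      rintro S ⟨h1, σ, h2, h3, h4⟩ S' ⟨h1', σ', h2', h3', h4'⟩
      exact ⟨T.inter h1 h1', σ ∩ σ', T.inter h2 h2', ⟨h3, h3'⟩, fun e he hw =>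
        ⟨h4 e (fun i => (he i).1) hw, h4' e (fun i => (he i).2) hw⟩⟩)
    (by
      rintro S ⟨h1, σ, h2, h3, h4⟩
      obtain ⟨e, he, hw⟩ := hcon σ h2 h3
      exact ⟨e, h4 e he hw⟩)
  have hW' := he {v | v ∘ Sum.inl ∈ Wᶜ} ⟨T.pre _ (T.compl hW), Set.univ, T.univ, trivial,
    fun e _ hw => hw⟩
  refine hW' (h e fun i => ?_)
  have key : ∀ σ : Set (κ → U), T.Def σ → D ∈ σ → (fun z => e (i, z)) ∈ σ := by
    intro σ hσ hD
    exact he {v | v ∘ (fun z => Sum.inl (i, z)) ∈ σ} ⟨T.pre _ hσ, σ, hσ, hD,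
      fun e h _ => h i⟩
  intro S hS
  refine ⟨key S hS, fun h1 => ?_⟩
  by_contra h2
  exact key _ (T.compl hS) h2 h1

def dd {γ : Type} (n : ℕ) (g : ℕ → γ → U) : (Fin n × γ) ⊕ (Fin n × γ) → U :=
  Sum.elim (fun p => g p.1 p.2) (fun p => g (n + 1 + p.1) p.2)

variable (T) in
/-- distality for the formula `φ`, in finitary form -/
def DistalFor {α γ : Type} (φ : Set (α ⊕ γ → U)) : Prop :=
  ∃ (n : ℕ) (Θ : Set (α ⊕ ((Fin n × γ) ⊕ (Fin n × γ)) → U))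
    (X : Set (γ ⊕ ((Fin n × γ) ⊕ (Fin n × γ)) → U)), T.Def Θ ∧ T.Def X ∧
    (∀ x y d, Sum.elim x d ∈ Θ → Sum.elim y d ∈ X → Sum.elim x y ∈ φ) ∧
    ∀ (g : ℕ → γ → U) (a : α → U), (∀ (m : ℕ) (i j : Fin m → ℕ), StrictMono i → StrictMono j →
      (∀ l, i l < 2 * n + 1) → (∀ l, j l < 2 * n + 1) →
      T.eqv (Sum.elim a (tup g i)) (Sum.elim a (tup g j))) →
      (∀ i, i < 2 * n + 1 → Sum.elim a (g i) ∈ φ) →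
      Sum.elim a (dd n g) ∈ Θ ∧ Sum.elim (g n) (dd n g) ∈ X

theorem abstract_main {α γ : Type} [Finite α] [Finite γ] {φ : Set (α ⊕ γ → U)} (hφ : T.Def φ)
    {b : γ → U} (hND : T.ND φ b) (hD : T.DistalFor φ) :
    ∃ ψ : Set (γ → U), T.Def ψ ∧ b ∈ ψ ∧ ∀ (k : ℕ) (bs : Fin k → γ → U), (∀ i, bs i ∈ ψ) →
      ∃ x : α → U, ∀ i, Sum.elim x (bs i) ∈ φ := by
  obtain ⟨qx, hqx⟩ := exists_free hφ (free_of_nd hφ hND)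
  obtain ⟨q, hqb, hq⟩ := exists_strict (T := T) b
  have hqe : ∀ {β : Type} (h : β → U) (e : γ → U), q.Rel h e → T.eqv b e := fun h e he =>
    (q.inv (eqv.refl _) hqb (q.mono' (β' := Empty) he Empty.elim (g := Empty.elim)
        (fun i => i.elim))).of Sum.inl (fun _ => rfl) (fun _ => rfl)
  obtain ⟨n, Θ, X, hΘ, hX, hΘX, hdis⟩ := hD
  let g := morleySeq q (Empty.elim : Empty → U)
  have hg : ∀ k, Morley q (Empty.elim : Empty → U) g k := fun k => morleySeq_spec q _ k
  obtain ⟨a, ha⟩ := qx.ex (initSeg g (2 * n + 1))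
  have haD : qx.Rel (dd n g) a := qx.mono' ha (Sum.elim
    (fun p => (⟨p.1, by omega⟩, p.2)) (fun p => (⟨n + 1 + p.1, by omega⟩, p.2)))
    (by rintro (x | x) <;> rfl)
  obtain ⟨hΘ1, hX1⟩ := hdis g a
    (by
      intro m i j hi hj hi' hj'
      refine qx.inv ?_ (qx.mono' ha (fun p => (⟨i p.1, hi' _⟩, p.2)) (fun _ => rfl))
        (qx.mono' ha (fun p => (⟨j p.1, hj' _⟩, p.2)) (fun _ => rfl))
      exact ((hg _).indisc hi hj hi' hj').of Sum.inl (fun _ => rfl) (fun _ => rfl))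
    (by
      intro i hi
      exact hqx _ _ (hqe _ _ (hg (i + 1) i (by omega)))
        (qx.mono' ha (fun z => (⟨i, hi⟩, z)) (fun _ => rfl)))
  set D := dd n g with hDdef
  -- common realizations for Θ
  have hA : ∀ (s : ℕ) (e : Fin s × ((Fin n × γ) ⊕ (Fin n × γ)) → U),
      (∀ i, T.eqv D (fun z => e (i, z))) →
      ∃ x : α → U, ∀ i, Sum.elim x (fun z => e (i, z)) ∈ Θ := by
    intro s e he
    obtain ⟨x, hx⟩ := qx.ex e
    refine ⟨x, fun i => ?_⟩
    exact (qx.inv (he i) haD (qx.mono' hx (fun z => (i, z)) (fun _ => rfl)) Θ hΘ).1 hΘ1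
  have hB : ∀ (s : ℕ) (e : Fin s × γ → U), (∀ i, T.eqv b (fun z => e (i, z))) →
      ∃ d, T.eqv D d ∧ ∀ i, Sum.elim (fun z => e (i, z)) d ∈ X := by
    intro s e he
    rcases Nat.eq_zero_or_pos s with rfl | hs
    · exact ⟨D, eqv.refl _, fun i => i.elim0⟩
    have hgn : q.Rel (initSeg g n) (g n) := q.mono' (hg (n + 1) n (by omega)) Sum.inl (fun _ => rfl)
    obtain ⟨R, hR⟩ := hq _ _ hgn
    obtain ⟨dl, hdl⟩ := R.ex e
    obtain ⟨dr, hdr⟩ := (Pow q n).ex (Sum.elim dl e)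
    have hpow : (Pow q n).Rel (Sum.elim (initSeg g n) (g n))
        (fun p => g (n + 1 + p.1) p.2) := by
      refine ⟨g ∘ fun l => n + 1 + l, ?_, fun _ => rfl⟩
      refine (hg (2 * n + 1)).sub (k' := n) (fun l => n + 1 + l) (fun j hj => by omega)
        (fun i j h1 h2 => by omega) ?_
      intro j hj
      refine ⟨Sum.elim (fun p => Sum.inl (⟨p.1, by omega⟩, p.2))
        (fun z => Sum.inl (⟨n, by omega⟩, z)), ?_⟩
      rintro (x | x) <;> rfl
    have heq : ∀ i, T.eqv (Sum.elim (fun p : Fin n × γ => g (n + 1 + p.1) p.2)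
        (Sum.elim (initSeg g n) (g n))) (Sum.elim dr (Sum.elim dl (fun z => e (i, z)))) := by
      intro i
      refine (Pow q n).inv (R.inv ((hqe _ _ hgn).symm.trans (he i)) hR
        (R.mono' hdl (fun z => (i, z)) (fun _ => rfl))) hpow ?_
      refine (Pow q n).mono' hdr (Sum.map id (fun z => (i, z))) ?_
      rintro (x | x) <;> rfl
    refine ⟨Sum.elim dl dr, ?_, fun i => ?_⟩
    · refine (heq ⟨0, hs⟩).of (Sum.elim (fun x => Sum.inr (Sum.inl x)) Sum.inl) ?_ ?_ <;>
      rintro (x | x) <;> rfl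
    · refine (((heq i).of (Sum.elim (fun x => Sum.inr (Sum.inr x))
        (Sum.elim (fun x => Sum.inr (Sum.inl x)) Sum.inl)) ?_ ?_) X hX).1 hX1 <;>
      rintro (x | x | x) <;> rfl
  obtain ⟨r, hr, hr'⟩ := noShat hX
  obtain ⟨s, hs⟩ := cover hr hr'
  obtain ⟨σ, hσ, hDσ, hσ'⟩ := compact_pow (consist_def (F := Fin s) hΘ) D (hA s)
  have hW : T.Def {e : Fin s × γ → U | ∃ d ∈ σ, ∀ i, Sum.elim (fun z => e (i, z)) d ∈ X} := by
    have h2 := T.proj (T.inter (Def_iInter (ι := Fin s) (S := fun f =>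
        {u : ((Fin n × γ) ⊕ (Fin n × γ)) ⊕ (Fin s × γ) → U |
          u ∘ Sum.elim (fun z => Sum.inr (f, z)) Sum.inl ∈ X}) fun f =>
        T.pre _ hX) (T.pre Sum.inl hσ))
    convert h2 using 1
    ext e
    refine exists_congr fun d => ?_
    rw [and_comm]
    refine and_congr (forall_congr' fun f => mcong (S := X) ?_) Iff.rfl
    rintro (x | x) <;> rfl
  obtain ⟨ψ, hψ, hbψ, hψ'⟩ := compact_pow hW b (by
    intro e he
    obtain ⟨d, h1, h2⟩ := hB s e he
    exact ⟨d, (h1 σ hσ).1 hDσ, h2⟩)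
  refine ⟨ψ, hψ, hbψ, fun k bs hbs => ?_⟩
  obtain ⟨c, hc, hc'⟩ := hs k bs σ ⟨D, hDσ⟩ (by
    intro f
    obtain ⟨d, h1, h2⟩ := hψ' (fun p => bs (f p.1) p.2) (fun i => hbs (f i))
    exact ⟨d, h1, h2⟩)
  obtain ⟨x, hx⟩ := hσ' (fun p => c p.1 p.2) hc
  refine ⟨x, fun i => ?_⟩
  obtain ⟨j, hj⟩ := hc' i
  exact hΘX _ _ _ (hx j) hj

end Sys
end

section
section ModelTheory
variable {L : FirstOrder.Language.{u, v}}

theorem ex_transfer {A B : Type*} [L.Structure A] [L.Structure B] (f : A ↪ₑ[L] B)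
    {α γ ι : Type*} [Finite α] (s : Finset ι) (F : ι → L.Formula (α ⊕ γ)) (c : γ → A) :
    (∃ v : α → B, ∀ i ∈ s, (F i).Realize (Sum.elim v (f ∘ c))) ↔
    (∃ v : α → A, ∀ i ∈ s, (F i).Realize (Sum.elim v c)) := by
  classical
  let θ : L.Formula γ := Formula.iExs α
    (Formula.iInf (fun i : s => (F i.1).relabel (Sum.swap : α ⊕ γ → γ ⊕ α)))
  have key : ∀ {K : Type _} [L.Structure K] (c : γ → K), θ.Realize c ↔
      ∃ v : α → K, ∀ i ∈ s, (F i).Realize (Sum.elim v c) := by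
    intro K _ c
    simp only [θ, Formula.realize_iExs, Formula.realize_iInf, Formula.realize_relabel]
    refine exists_congr fun v => ?_
    have : (Sum.elim c v ∘ (Sum.swap : α ⊕ γ → γ ⊕ α)) = Sum.elim v c := by
      funext x; rcases x with x | x <;> rfl
    simp [this]
  have key' : ∀ {K : Type _} [L.Structure K] (c : γ → K), θ.Realize c ↔
      ∃ v : α → K, ∀ i ∈ s, (F i).Realize (Sum.elim v c) := by
    intro K _ c
    simp only [θ, Formula.realize_iExs, Formula.realize_iInf, Formula.realize_relabel]
    refine exists_congr fun v => ?_
    have : (Sum.elim c v ∘ (Sum.swap : α ⊕ γ → γ ⊕ α)) = Sum.elim v c := by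
      funext x; rcases x with x | x <;> rfl
    simp [this]
  rw [← key, ← key', f.map_formula]

theorem compactness {U : Type w} [L.Structure U] [Nonempty U] {V : Type*} {ι : Type (max u v w)}
    (F : ι → L.Formula (V ⊕ U))
    (h : ∀ s : Finset ι, ∃ v : V → U, ∀ i ∈ s, (F i).Realize (Sum.elim v id)) :
    ∃ (E : ElemExt.{u, v, w} L U) (v : V → E.Carrier), ∀ i, (F i).Realize (Sum.elim v E.emb) := by
  classical
  choose v hv using h
  let W : Ultrafilter (Finset ι) := Ultrafilter.of Filter.atTop
  have hW : (W : Filter (Finset ι)) ≤ Filter.atTop := Ultrafilter.of_le _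
  let P := (W : Filter (Finset ι)).Product (fun _ => U)
  let e : U ↪ₑ[L] P :=
    { toFun := fun x => ((fun _ => x : Finset ι → U) : P)
      map_formula' := by
        intro n φ x
        have := Ultraproduct.realize_formula_cast (L := L) (u := W) (M := fun _ => U) φ
          (fun i _ => x i)
        refine Iff.trans this ?_
        simp }
  refine ⟨⟨P, e⟩, fun x => ((fun s => v s x : Finset ι → U) : P), fun i => ?_⟩
  have := Ultraproduct.realize_formula_cast (L := L) (u := W) (M := fun _ => U) (F i)
    (Sum.elim (fun x s => v s x) (fun x _ => x))
  have h2 : (fun y => ((Sum.elim (fun x s => v s x) (fun x _ => x) y : Finset ι → U) : P)) =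
    Sum.elim (fun x => ((fun s => v s x : Finset ι → U) : P)) (e : U → P) := by
    funext y; rcases y with y | y <;> rfl
  have g := this.2 (by
    refine hW ?_
    filter_upwards [Filter.Ici_mem_atTop ({i} : Finset ι)] with s hs
    have := hv s i (hs (by simp))
    convert this using 1
    funext y; rcases y with y | y <;> rfl)
  rw [h2] at g
  exact g

/-- finitely satisfiable sets of formulas over `U` -/
def FS (U : Type w) [L.Structure U] (k : ℕ) (p : Set (L.Formula (Fin k ⊕ U))) : Prop :=
  ∀ t : Finset (L.Formula (Fin k ⊕ U)), (∀ θ ∈ t, θ ∈ p) →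
    ∃ v : Fin k → U, ∀ θ ∈ t, θ.Realize (Sum.elim v id)

theorem sat_step (U : Type (max u v w)) [L.Structure U] [Nonempty U] :
    ∃ E : ElemExt.{u, v, max u v w} L U, ∀ k (p : Set (L.Formula (Fin k ⊕ U))), FS U k p →
      ∃ v : Fin k → E.Carrier, ∀ θ ∈ p, θ.Realize (Sum.elim v E.emb) := by
  classical
  let Q : Type (max u v w) := {q : Σ k, Set (L.Formula (Fin k ⊕ U)) // FS U q.1 q.2}
  let V : Type (max u v w) := Σ q : Q, Fin q.1.1
  let ι : Type (max u v w) := Σ q : Q, q.1.2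
  let F : ι → L.Formula (V ⊕ U) := fun i =>
    Formula.relabel (Sum.map (fun j => (⟨i.1, j⟩ : V)) id) i.2.1
  obtain ⟨E, v, hv⟩ := compactness (U := U) F (by
    intro s
    have : ∀ q : Q, ∃ v : Fin q.1.1 → U, ∀ i ∈ s, ∀ h : i.1 = q,
        (h ▸ i.2 : q.1.2).1.Realize (Sum.elim v id) := by
      intro q
      let t : Finset (L.Formula (Fin q.1.1 ⊕ U)) := 
        s.biUnion (fun i => if h : i.1 = q then {(h ▸ i.2 : q.1.2).1} else ∅)
      obtain ⟨v, hv⟩ := q.2 t (by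
        intro θ hθ
        simp only [t, Finset.mem_biUnion] at hθ
        obtain ⟨i, _, hi⟩ := hθ
        split_ifs at hi with h
        · rw [Finset.mem_singleton] at hi
          rw [hi]; exact (h ▸ i.2 : q.1.2).2
        · simp at hi)
      refine ⟨v, fun i hi h => hv _ ?_⟩
      simp only [t, Finset.mem_biUnion]
      exact ⟨i, hi, by simp [h]⟩
    choose v hv using this
    refine ⟨fun x => v x.1 x.2, fun i hi => ?_⟩
    have := hv i.1 i hi rfl
    simp only [F, Formula.realize_relabel]
    convert this using 1
    funext y; rcases y with y | y <;> rfl)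
  refine ⟨E, fun k p hp => ⟨fun j => v ⟨⟨⟨k, p⟩, hp⟩, j⟩, fun θ hθ => ?_⟩⟩
  have := hv ⟨⟨⟨k, p⟩, hp⟩, ⟨θ, hθ⟩⟩
  simp only [F, Formula.realize_relabel] at this
  convert this using 1
  funext y; rcases y with y | y <;> rfl

end ModelTheory
end

section
section ModelTheory
variable {L : FirstOrder.Language.{u, v}}

theorem limit_elementary {G : ℕ → Type w} [∀ i, L.Structure (G i)]
    (f : ∀ n, G n ↪ₑ[L] G (n + 1)) :
    ∃ (D : Type w) (_ : L.Structure D) (e : ∀ n, G n ↪ₑ[L] D),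
      (∀ n x, e (n + 1) (f n x) = e n x) ∧ ∀ z : D, ∃ n x, e n x = z := by
  classical
  let f' : ∀ n, G n ↪[L] G (n + 1) := fun n => (f n).toEmbedding
  let fe : ∀ i j, i ≤ j → G i ↪[L] G j := fun i j h => DirectedSystem.natLERec f' i j h
  have : DirectedSystem G (fun i j h => fe i j h) := DirectedSystem.natLERec.directedSystem f'
  let D := Language.DirectLimit G fe
  let o : ∀ i, G i ↪[L] D := fun i => Language.DirectLimit.of L ℕ G fe i
  have ho : ∀ i j (h : i ≤ j) x, o j (fe i j h x) = o i x := fun i j h x => Language.DirectLimit.of_f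
  have hfe : ∀ i j (h : i ≤ j) {n : ℕ} {β : Type} (φ : L.BoundedFormula β n) (a : β → G i)
      (x : Fin n → G i), φ.Realize (fe i j h ∘ a) (fe i j h ∘ x) ↔ φ.Realize a x := by
    intro i j h
    induction j, h using Nat.le_induction with
    | base =>
      intro n β φ a x
      have : (fe i i le_rfl : G i → G i) = id := by
        funext x; exact DirectedSystem.map_self (f := fun i j h => (fe i j h : G i → G j)) x
      rw [this]; rfl
    | succ j h ih =>
      intro n β φ a x
      have : (fe i (j+1) (h.trans (Nat.le_succ j)) : G i → G (j+1)) = f j ∘ fe i j h := by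
        funext x
        show DirectedSystem.natLERec f' i (j + 1) _ x = _
        unfold DirectedSystem.natLERec
        rw [Nat.leRecOn_succ h]
        rfl
      rw [this, Function.comp_assoc, Function.comp_assoc, (f j).map_boundedFormula, ih]
  have hex : ∀ z : D, ∃ n x, o n x = z := fun z => Language.DirectLimit.exists_of z
  have main : ∀ {n : ℕ} {β : Type} (φ : L.BoundedFormula β n) (i : ℕ) (a : β → G i)
      (x : Fin n → G i), φ.Realize (o i ∘ a) (o i ∘ x) ↔ φ.Realize a x := by
    intro n β φ
    induction φ with
    | falsum => intro i a x; rfl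
    | equal t₁ t₂ =>
      intro i a x
      simp only [BoundedFormula.Realize, ← Sum.comp_elim, HomClass.realize_term, (o i).injective.eq_iff]
    | rel R ts =>
      intro i a x
      simp only [BoundedFormula.Realize, ← Sum.comp_elim, HomClass.realize_term]
      exact (o i).map_rel R _
    | imp _ _ ih1 ih2 => intro i a x; simp only [BoundedFormula.Realize, ih1, ih2]
    | all φ ih =>
      intro i a x
      simp only [BoundedFormula.Realize]
      constructor
      · intro h y
        have := h (o i y)
        rw [← Fin.comp_snoc] at this
        exact (ih i a _).1 this
      · intro h z
        obtain ⟨j, y, rfl⟩ := hex z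
        let k := max i j
        have hi : i ≤ k := le_max_left _ _
        have hj : j ≤ k := le_max_right _ _
        have e1 : (o i : G i → D) = o k ∘ fe i k hi := by funext x; exact (ho i k hi x).symm
        rw [← ho j k hj y, e1, Function.comp_assoc, Function.comp_assoc, ← Fin.comp_snoc]
        refine (ih k _ _).2 ?_
        have := (hfe i k hi φ.all a x).2 h
        exact this _
  refine ⟨D, inferInstance, fun n => ⟨o n, ?_⟩, ?_, hex⟩
  · intro m φ x
    have := main φ n x (default : Fin 0 → G n)
    have h0 : (o n ∘ (default : Fin 0 → G n)) = default := Subsingleton.elim _ _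
    rw [h0] at this
    exact this
  · intro n x
    have h1 : fe n (n + 1) (Nat.le_succ n) x = f n x := by
      show DirectedSystem.natLERec f' n (n + 1) _ x = _
      unfold DirectedSystem.natLERec
      rw [Nat.leRecOn_succ le_rfl, Nat.leRecOn_self]
      rfl
    have := ho n (n + 1) (Nat.le_succ n) x
    rw [h1] at this
    exact this

theorem exists_saturated (N : Type w) [L.Structure N] [Nonempty N] :
    ∃ E : ElemExt.{u, v, w} L N, ∀ (k : ℕ) (B : Type) [Finite B] (h : B → E.Carrier)
      (p : Set (L.Formula (Fin k ⊕ (B ⊕ N)))),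
      (∀ t : Finset (L.Formula (Fin k ⊕ (B ⊕ N))), (∀ θ ∈ t, θ ∈ p) →
        ∃ v : Fin k → E.Carrier, ∀ θ ∈ t, θ.Realize (Sum.elim v (Sum.elim h E.emb))) →
      ∃ v : Fin k → E.Carrier, ∀ θ ∈ p, θ.Realize (Sum.elim v (Sum.elim h E.emb)) := by
  classical
  obtain ⟨E0, -, -⟩ := compactness (L := L) (U := N) (V := Empty) (ι := PEmpty)
    (fun i => i.elim) (fun s => ⟨fun i => i.elim, fun i => i.elim⟩)
  let Ch := {S : Σ G : Type (max u v w), L.Structure G // Nonempty S.1}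
  have hst : ∀ S : Ch, ∃ (S' : Ch) (f : letI := S.1.2; letI := S'.1.2; S.1.1 ↪ₑ[L] S'.1.1),
      letI := S.1.2; letI := S'.1.2
      ∀ k (p : Set (L.Formula (Fin k ⊕ S.1.1))), FS S.1.1 k p →
        ∃ v : Fin k → S'.1.1, ∀ θ ∈ p, θ.Realize (Sum.elim v f) := by
    intro S
    let _ := S.1.2
    have := S.2
    obtain ⟨E, hE⟩ := sat_step (L := L) S.1.1
    exact ⟨⟨⟨E.Carrier, E.str⟩, this.map E.emb⟩, E.emb, hE⟩
  choose nx fx hx using hst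
  let ch : ℕ → Ch := fun n => Nat.rec ⟨⟨E0.Carrier, E0.str⟩, ‹Nonempty N›.map E0.emb⟩
    (fun _ S => nx S) n
  obtain ⟨G, instG, f, e0, hx⟩ : ∃ (G : ℕ → Type (max u v w)) (_ : ∀ n, L.Structure (G n))
      (f : ∀ n, G n ↪ₑ[L] G (n + 1)) (_ : N ↪ₑ[L] G 0),
      ∀ n k (p : Set (L.Formula (Fin k ⊕ G n))), FS (G n) k p →
        ∃ v : Fin k → G (n + 1), ∀ θ ∈ p, θ.Realize (Sum.elim v (f n)) :=
    ⟨fun n => (ch n).1.1, fun n => (ch n).1.2, fun n => fx (ch n), E0.emb, fun n => hx (ch n)⟩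
  obtain ⟨D, instD, e, he, hex⟩ := limit_elementary (L := L) f
  have up : ∀ n m, n ≤ m → ∀ x, ∃ y, e m y = e n x := by
    intro n m h
    induction m, h using Nat.le_induction with
    | base => exact fun x => ⟨x, rfl⟩
    | succ m h ih =>
      intro x
      obtain ⟨y, hy⟩ := ih x
      exact ⟨f m y, by rw [he, hy]⟩
  refine ⟨⟨D, (e 0).comp e0⟩, ?_⟩
  intro k B _ h p hp
  obtain ⟨n, c, hc⟩ : ∃ n, ∃ c : B ⊕ N → G n,
      e n ∘ c = Sum.elim h ((e 0).comp e0) := by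
    have := Fintype.ofFinite B
    choose nn xx hxx using fun i => hex (h i)
    let n := Finset.univ.sup nn
    have h1 : ∀ i, ∃ y, e n y = h i := fun i => by
      obtain ⟨y, hy⟩ := up (nn i) n (Finset.le_sup (Finset.mem_univ i)) (xx i)
      exact ⟨y, hy.trans (hxx i)⟩
    have h2 : ∀ i : N, ∃ y, e n y = e 0 (e0 i) := fun i => up 0 n (Nat.zero_le _) _
    choose c1 hc1 using h1
    choose c2 hc2 using h2
    refine ⟨n, Sum.elim c1 c2, ?_⟩
    funext y; rcases y with y | y
    · exact hc1 y
    · exact hc2 y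
  have hcv : ∀ v : Fin k → D, Sum.elim v (Sum.elim h ((e 0).comp e0)) =
      Sum.elim v (e n ∘ c) := fun v => by rw [hc]
  let p' : Set (L.Formula (Fin k ⊕ G n)) :=
    (fun θ => Formula.relabel (Sum.map id c) θ) '' p
  have hp' : FS (G n) k p' := by
    intro t ht
    choose! g hg using ht
    obtain ⟨v, hv⟩ := hp (t.image g) (by
      intro θ hθ
      obtain ⟨x, hx, rfl⟩ := Finset.mem_image.1 hθ
      exact (hg x hx).1)
    obtain ⟨v', hv'⟩ := (ex_transfer (e n) (t.image g) (fun θ => θ) c).1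
      ⟨v, fun i hi => by rw [← hcv]; exact hv i hi⟩
    refine ⟨v', fun θ hθ => ?_⟩
    have h1 := hv' _ (Finset.mem_image_of_mem g hθ)
    rw [← (hg θ hθ).2]
    simp only [Formula.realize_relabel]
    convert h1 using 1
    funext y; rcases y with y | y <;> rfl
  obtain ⟨v, hv⟩ := hx n k p' hp'
  refine ⟨e (n + 1) ∘ v, fun θ hθ => ?_⟩
  have h1 := hv _ ⟨θ, hθ, rfl⟩
  simp only [Formula.realize_relabel] at h1
  have h2 := ((e (n + 1)).map_formula θ _).2 h1
  convert h2 using 1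
  refine (hcv _).trans ?_
  funext y; rcases y with y | y
  · rfl
  · exact (he n _).symm

end ModelTheory
end

section
section ModelTheory
variable {L : FirstOrder.Language.{u, v}} {M0 : Type w} [L.Structure M0]
  {U : Type (max u v w)} [L.Structure U] (j : M0 ↪ₑ[L] U)

theorem defM {γ : Type*} {S : Set (γ → U)} : (Set.range j).Definable L S ↔
    ∃ ψ : L.Formula (γ ⊕ M0), S = {v | ψ.Realize (Sum.elim v j)} := by
  rw [Set.definable_iff_exists_formula_sum]
  constructor
  · rintro ⟨φ, rfl⟩
    choose g hg using fun x : Set.range j => x.2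
    refine ⟨φ.relabel (Sum.elim (Sum.inr ∘ g) Sum.inl), ?_⟩
    ext v
    simp only [Set.mem_ofPred_eq, Formula.realize_relabel]
    have : (Sum.elim v j ∘ Sum.elim (Sum.inr ∘ g) Sum.inl) =
        Sum.elim (fun x : Set.range j => (x : U)) v := by
      funext y; rcases y with y | y
      · exact hg y
      · rfl
    rw [this]
  · rintro ⟨ψ, rfl⟩
    refine ⟨ψ.relabel (Sum.elim Sum.inr (fun m => Sum.inl ⟨j m, m, rfl⟩)), ?_⟩
    ext v
    simp only [Set.mem_ofPred_eq, Formula.realize_relabel]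
    have : (Sum.elim (fun x : Set.range j => (x : U)) v ∘
      Sum.elim Sum.inr (fun m => Sum.inl ⟨j m, m, rfl⟩)) = Sum.elim v j := by
      funext y; rcases y with y | y <;> rfl
    rw [this]

theorem def_of {γ δ : Type*} (ψ : L.Formula (γ ⊕ δ)) (m : δ → M0) :
    (Set.range j).Definable L {v : γ → U | ψ.Realize (Sum.elim v (j ∘ m))} := by
  rw [defM]
  refine ⟨ψ.relabel (Sum.map id m), ?_⟩
  ext v
  simp only [Set.mem_ofPred_eq, Formula.realize_relabel]
  have : (Sum.elim v j ∘ Sum.map id m) = Sum.elim v (j ∘ m) := by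
    funext y; rcases y with y | y <;> rfl
  rw [this]

theorem finrep {γ : Type*} {S : Set (γ → U)} (h : (Set.range j).Definable L S) :
    ∃ (n : ℕ) (ψ : L.Formula (γ ⊕ Fin n)) (m : Fin n → M0),
      S = {v | ψ.Realize (Sum.elim v (j ∘ m))} := by
  rw [Set.definable_iff_finitely_definable] at h
  obtain ⟨A0, hA, h⟩ := h
  rw [Set.definable_iff_exists_formula_sum] at h
  obtain ⟨φ, rfl⟩ := h
  choose g hg using fun x : (A0 : Set U) => hA x.2
  let e : (A0 : Set U) ≃ Fin A0.card := A0.equivFin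
  refine ⟨A0.card, φ.relabel (Sum.elim (Sum.inr ∘ e) Sum.inl), g ∘ e.symm, ?_⟩
  ext v
  simp only [Set.mem_ofPred_eq, Formula.realize_relabel]
  have : (Sum.elim v (j ∘ g ∘ e.symm) ∘ Sum.elim (Sum.inr ∘ e) Sum.inl) =
      Sum.elim (fun x : (A0 : Set U) => (x : U)) v := by
    funext y; rcases y with y | y
    · simpa using hg y
    · rfl
  rw [this]

def SatHyp : Prop := ∀ (k : ℕ) (B : Type) [Finite B] (h : B → U)
      (p : Set (L.Formula (Fin k ⊕ (B ⊕ M0)))),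
      (∀ t : Finset (L.Formula (Fin k ⊕ (B ⊕ M0))), (∀ θ ∈ t, θ ∈ p) →
        ∃ v : Fin k → U, ∀ θ ∈ t, θ.Realize (Sum.elim v (Sum.elim h j))) →
      ∃ v : Fin k → U, ∀ θ ∈ p, θ.Realize (Sum.elim v (Sum.elim h j))

theorem sys_sat (hsat : SatHyp j) {α β : Type} [Finite α] [Finite β] (h : β → U)
    (P : Set (Set (α ⊕ β → U))) (hP : ∀ S ∈ P, (Set.range j).Definable L S)
    (hf : ∀ t : Finset (Set (α ⊕ β → U)), (∀ S ∈ t, S ∈ P) →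
      ∃ v : α → U, ∀ S ∈ t, Sum.elim v h ∈ S) :
    ∃ v : α → U, ∀ S ∈ P, Sum.elim v h ∈ S := by
  classical
  let e := Finite.equivFin α
  have hrep : ∀ S ∈ P, ∃ θ : L.Formula (Fin (Nat.card α) ⊕ (β ⊕ M0)), ∀ v : Fin (Nat.card α) → U,
      (Sum.elim (v ∘ e) h ∈ S ↔ θ.Realize (Sum.elim v (Sum.elim h j))) := by
    intro S hS
    obtain ⟨ψ, rfl⟩ := (defM j).1 (hP S hS)
    refine ⟨ψ.relabel (Sum.elim (Sum.elim (Sum.inl ∘ e) (Sum.inr ∘ Sum.inl)) (Sum.inr ∘ Sum.inr)),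
      fun v => ?_⟩
    simp only [Set.mem_ofPred_eq, Formula.realize_relabel]
    apply iff_of_eq
    congr 1
    funext y; rcases y with (y | y) | y <;> rfl
  choose! θ hθ using hrep
  obtain ⟨v, hv⟩ := hsat _ β h (θ '' P) (by
    intro t ht
    choose! g hg using ht
    obtain ⟨v, hv⟩ := hf (t.image g) (by
      intro S hS
      obtain ⟨x, hx, rfl⟩ := Finset.mem_image.1 hS
      exact (hg x hx).1)
    refine ⟨v ∘ e.symm, fun x hx => ?_⟩
    rw [← (hg x hx).2, ← hθ _ (hg x hx).1]
    have := hv _ (Finset.mem_image_of_mem g hx)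
    convert this using 2
    funext y; simp)
  exact ⟨v ∘ e, fun S hS => (hθ S hS v).2 (hv _ ⟨S, hS, rfl⟩)⟩

theorem sys_nip (hnip : IsNIP L M0) [Nonempty U] {α β : Type} [Finite α] [Finite β]
    {S : Set (α ⊕ β → U)} (hS : (Set.range j).Definable L S) :
    ∃ d : ℕ, ¬ ∃ (a : Fin d → α → U) (b : Set (Fin d) → β → U),
      ∀ i X, Sum.elim (a i) (b X) ∈ S ↔ i ∈ X := by
  classical
  by_contra hcon
  push Not at hcon
  obtain ⟨np, ψ, m, rfl⟩ := finrep j hS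
  let e := Finite.equivFin α
  let e' : β ⊕ Fin np ≃ Fin (Nat.card (β ⊕ Fin np)) := Finite.equivFin _
  let χ : L.Formula (Fin (Nat.card α) ⊕ Fin (Nat.card (β ⊕ Fin np))) :=
    ψ.relabel (Sum.elim (Sum.elim (Sum.inl ∘ e) (Sum.inr ∘ e' ∘ Sum.inl)) (Sum.inr ∘ e' ∘ Sum.inr))
  have hχ : ∀ (a : α → U) (b : β → U), χ.Realize (Sum.elim (a ∘ e.symm)
      (Sum.elim b (j ∘ m) ∘ e'.symm)) ↔ ψ.Realize (Sum.elim (Sum.elim a b) (j ∘ m)) := by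
    intro a b
    simp only [χ, Formula.realize_relabel]
    apply iff_of_eq
    congr 1
    funext y; rcases y with (y | y) | y <;> simp
  let V := (ℕ × Fin (Nat.card α)) ⊕ (Set ℕ × Fin (Nat.card (β ⊕ Fin np)))
  let F0 : ℕ → Set ℕ → L.Formula (V ⊕ U) := fun i X =>
    χ.relabel (Sum.elim (fun x => Sum.inl (Sum.inl (i, x))) (fun y => Sum.inl (Sum.inr (X, y))))
  have hF0 : ∀ {K : Type (max u v w)} [L.Structure K] i X (v : V → K) (c : U → K),
      (F0 i X).Realize (Sum.elim v c) ↔ χ.Realize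
        (Sum.elim (fun x => v (Sum.inl (i, x))) (fun y => v (Sum.inr (X, y)))) := by
    intro K _ i X v c
    simp only [F0, Formula.realize_relabel]
    apply iff_of_eq
    congr 1
    funext y; rcases y with y | y <;> simp
  let F : ULift.{max u v w} (ℕ × Set ℕ) → L.Formula (V ⊕ U) := fun p =>
    if p.down.1 ∈ p.down.2 then F0 p.down.1 p.down.2 else ∼(F0 p.down.1 p.down.2)
  obtain ⟨E, v, hv⟩ := compactness (U := U) F (by
    intro s
    let d := s.sup (fun p => p.down.1) + 1
    obtain ⟨a, b, hab⟩ := hcon d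
    let v : V → U := Sum.elim
      (fun x => (if h : x.1 < d then a ⟨x.1, h⟩ else fun _ => Classical.arbitrary U) (e.symm x.2))
      (fun y => (Sum.elim (b {i | (i : ℕ) ∈ y.1}) (j ∘ m) ∘ e'.symm) y.2)
    refine ⟨v, fun p hp => ?_⟩
    have hlt : p.down.1 < d := Nat.lt_succ_of_le (Finset.le_sup (f := fun p => p.down.1) hp)
    have h1 : (F0 p.down.1 p.down.2).Realize (Sum.elim v id) ↔ p.down.1 ∈ p.down.2 := by
      rw [hF0]
      have := (hχ (a ⟨p.down.1, hlt⟩) (b {i | (i : ℕ) ∈ p.down.2})).trans (hab _ _)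
      refine Iff.trans ?_ this
      apply iff_of_eq
      congr 1
      funext y; rcases y with y | y
      · simp [v, hlt]
      · rfl
    simp only [F]
    split_ifs with h
    · exact h1.2 h
    · exact fun h' => h (h1.1 h'))
  have hmod : E.Carrier ⊨ L.completeTheory M0 := by
    have h1 : M0 ≅[L] E.Carrier := (E.emb.comp j).elementarilyEquivalent
    exact h1.theory_model
  have : Nonempty E.Carrier := ‹Nonempty U›.map E.emb
  refine hnip _ _ χ ⟨⟨E.Carrier⟩, fun i x => v (Sum.inl (i, x)), fun X y => v (Sum.inr (X, y)), ?_⟩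
  intro i X
  have := hv ⟨(i, X)⟩
  simp only [F] at this
  refine (hF0 i X v E.emb).symm.trans ?_
  split_ifs at this with h
  · exact iff_of_true this h
  · exact iff_of_false this h

def mkSys [Nonempty U] (hsat : SatHyp j) (hnip : IsNIP L M0) : Sys U where
  M := Set.range j
  Def := fun S => (Set.range j).Definable L S
  univ := Set.definable_univ
  compl := fun h => h.compl
  inter := fun h h' => h.inter h'
  pre := fun f _ h => h.preimage_comp f
  proj := by
    intro α β _ S h
    have h1 := h.preimage_comp (Sum.swap : α ⊕ β → β ⊕ α)
    have h2 := h1.exists_of_finite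
    convert h2 using 1
    ext v
    simp only [Set.mem_ofPred_eq, Set.mem_preimage]
    refine exists_congr fun w => ?_
    apply iff_of_eq; congr 1
    funext y; rcases y with y | y <;> rfl
  tv := by
    rintro γ _ S h ⟨v, hv⟩
    obtain ⟨ψ, rfl⟩ := (defM j).1 h
    obtain ⟨v, hv⟩ := (ex_transfer j {()} (fun _ => ψ) id).1 ⟨v, fun _ _ => hv⟩
    refine ⟨j ∘ v, ?_, fun i => ⟨_, rfl⟩⟩
    have := (j.map_formula ψ _).2 (hv () (by simp))
    simp only [Set.mem_ofPred_eq]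
    convert this using 1
    funext y; rcases y with y | y <;> rfl
  fiber := by
    intro α β _ S h m hm
    obtain ⟨ψ, rfl⟩ := (defM j).1 h
    choose m' hm' using hm
    refine (defM j).2 ⟨ψ.relabel (Sum.elim (Sum.elim (Sum.inr ∘ m') Sum.inl) Sum.inr), ?_⟩
    ext v
    simp only [Set.mem_ofPred_eq, Formula.realize_relabel]
    apply iff_of_eq; congr 1
    funext y; rcases y with (y | y) | y
    · simp [hm']
    · rfl
    · rfl
  sat := fun h P hP hf => sys_sat j hsat h P hP hf
  nip := fun hS => sys_nip j hnip hS

end ModelTheory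
end

section
section ModelTheory
variable {L : FirstOrder.Language.{u, v}} {M0 : Type w} [L.Structure M0]
  {U : Type (max u v w)} [L.Structure U] (j : M0 ↪ₑ[L] U)

def pos {κ γ : Type*} (n : ℕ) (y : γ → κ) (l r : Fin n × γ → κ) (z : ℤ) (q : γ) : κ :=
  if h : -(n : ℤ) ≤ z ∧ z < 0 then l (⟨(z + n).toNat, by omega⟩, q)
  else if h : 0 < z ∧ z ≤ n then r (⟨(z - 1).toNat, by omega⟩, q) else y q

theorem comp_pos {κ κ' γ : Type*} (f : κ → κ') (n : ℕ) (y : γ → κ) (l r : Fin n × γ → κ) (z : ℤ)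
    (q : γ) : f (pos n y l r z q) = pos n (f ∘ y) (f ∘ l) (f ∘ r) z q := by
  unfold pos; split_ifs <;> rfl

theorem pos_congr {κ γ : Type*} (n : ℕ) (y y' : γ → κ) (l r : Fin n × γ → κ) (z : ℤ) (hz : z ≠ 0)
    (hn : z.natAbs ≤ n) (q : γ) : pos n y l r z q = pos n y' l r z q := by
  unfold pos; split_ifs
  · rfl
  · rfl
  · omega

theorem pos_dd {κ γ : Type*} (n : ℕ) (g : ℕ → γ → κ) (y : γ → κ) (z : ℤ)
    (hn : z.natAbs ≤ n) (hy : z = 0 → y = g n) (q : γ) :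
    pos n y (fun p => g p.1 p.2) (fun p => g (n + 1 + p.1) p.2) z q = g (z + n).toNat q := by
  unfold pos; split_ifs
  · rfl
  · simp only; congr 1; omega
  · rw [hy (by omega)]; congr 1; omega

/-- index type for the indiscernibility conditions (whole sequence) -/
structure IA (L : FirstOrder.Language.{u, v}) (γ : Type) where
  m : ℕ
  i : Fin m → ℤ
  i' : Fin m → ℤ
  hi : StrictMono i
  hi' : StrictMono i'
  δ : L.Formula (Fin m × γ)

/-- index type for the indiscernibility conditions over `a` with `0` omitted -/
structure IB (L : FirstOrder.Language.{u, v}) (α γ : Type) where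
  m : ℕ
  i : Fin m → ℤ
  i' : Fin m → ℤ
  hi : StrictMono i
  hi' : StrictMono i'
  h0 : ∀ l, i l ≠ 0
  h0' : ∀ l, i' l ≠ 0
  δ : L.Formula (α ⊕ (Fin m × γ))

def IA.F {γ : Type} (c : IA L γ) : L.Formula (ℤ × γ) :=
  (c.δ.relabel (fun p => (c.i p.1, p.2))).iff (c.δ.relabel (fun p => (c.i' p.1, p.2)))

def IB.F {α γ : Type} (c : IB L α γ) : L.Formula (α ⊕ ℤ × γ) :=
  (c.δ.relabel (Sum.map id (fun p => (c.i p.1, p.2)))).iff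
    (c.δ.relabel (Sum.map id (fun p => (c.i' p.1, p.2))))

theorem IA.realize {γ : Type} (c : IA L γ) {K : Type*} [L.Structure K] (b : ℤ → γ → K) :
    c.F.Realize (fun p => b p.1 p.2) ↔
      (c.δ.Realize (Sys.tup b c.i) ↔ c.δ.Realize (Sys.tup b c.i')) := by
  simp only [IA.F, Formula.realize_iff, Formula.realize_relabel]
  rfl

theorem IB.realize {α γ : Type} (c : IB L α γ) {K : Type*} [L.Structure K] (a : α → K)
    (b : ℤ → γ → K) :
    c.F.Realize (Sum.elim a (fun p => b p.1 p.2)) ↔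
      (c.δ.Realize (Sum.elim a (Sys.tup b c.i)) ↔ c.δ.Realize (Sum.elim a (Sys.tup b c.i'))) := by
  simp only [IB.F, Formula.realize_iff, Formula.realize_relabel, Sum.elim_comp_map]
  rfl

theorem distal_incons {α γ : Type} [Finite α] [Finite γ] (hd : IsDistal L M0)
    (φ : L.Formula (α ⊕ γ)) (E : ElemExt.{u, v, w} L M0) (a : α → E.Carrier) (b : ℤ → γ → E.Carrier)
    (hA : ∀ c : IA L γ, c.F.Realize (fun p => b p.1 p.2))
    (hB : ∀ c : IB L α γ, c.F.Realize (Sum.elim a (fun p => b p.1 p.2)))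
    (h1 : φ.Realize (Sum.elim a (b 1))) : φ.Realize (Sum.elim a (b 0)) := by
  classical
  let e := Finite.equivFin γ
  let ea := Finite.equivFin α
  have hd2 := hd.2 E (Nat.card γ) (fun z l => b z (e.symm l)) (Set.range a) (by
    intro m i i' hi hi' p θ mm hmm
    have hp : IsEmpty (Fin p) := ⟨fun x => hmm x⟩
    have := (IA.realize _ b).1 (hA ⟨m, i, i', hi, hi', θ.relabel
      (Sum.elim (fun q => (q.1, e.symm q.2)) (fun x => (hmm x).elim))⟩)
    simp only [Formula.realize_relabel] at this
    convert this using 2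
    · funext y; rcases y with y | y
      · rfl
      · exact hp.elim y
    · funext y; rcases y with y | y
      · rfl
      · exact hp.elim y) (by
    intro m i i' hi hi' p θ mm hmm
    choose g hg using hmm
    have := (IB.realize _ a b).1 (hB ⟨m, fun l => i l, fun l => i' l, fun x y h => hi h,
      fun x y h => hi' h, fun l => (i l).2, fun l => (i' l).2, θ.relabel
      (Sum.elim (fun q => Sum.inr (q.1, e.symm q.2)) (fun x => Sum.inl (g x)))⟩)
    simp only [Formula.realize_relabel] at this
    convert this using 2
    · funext y; rcases y with y | y
      · rfl
      · exact (hg y).symm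
    · funext y; rcases y with y | y
      · rfl
      · exact (hg y).symm)
  have h2 := hd2 1 (fun _ => 0) (fun _ => 1) (Subsingleton.strictMono _) (Subsingleton.strictMono _)
    (Nat.card α) (φ.relabel (Sum.elim (fun x => Sum.inr (ea x)) (fun y => Sum.inl (0, e y))))
    (a ∘ ea.symm) (fun i => ⟨_, rfl⟩)
  simp only [Formula.realize_relabel] at h2
  have h3 : ∀ z, (Sum.elim (fun q : Fin 1 × Fin (Nat.card γ) => b z (e.symm q.2)) (a ∘ ea.symm) ∘
    Sum.elim (fun x => Sum.inr (ea x)) (fun y => Sum.inl (0, e y))) = Sum.elim a (b z) := by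
    intro z; funext y; rcases y with y | y <;> simp
  rw [h3, h3] at h2
  exact h2.2 h1

theorem distal_finite (j : M0 ↪ₑ[L] U) [Nonempty U] {α γ : Type} [Finite α] [Finite γ] (hd : IsDistal L M0)
    (φ : L.Formula (α ⊕ γ)) : ∃ (sA : Finset (IA L γ)) (sB : Finset (IB L α γ)),
    ∀ (a : α → U) (b : ℤ → γ → U), (∀ c ∈ sA, c.F.Realize (fun p => b p.1 p.2)) →
      (∀ c ∈ sB, c.F.Realize (Sum.elim a (fun p => b p.1 p.2))) →
      φ.Realize (Sum.elim a (b 1)) → φ.Realize (Sum.elim a (b 0)) := by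
  classical
  by_contra hcon
  push Not at hcon
  let ι := ULift.{max u v w} (IA L γ ⊕ (IB L α γ ⊕ Bool))
  let G : IA L γ ⊕ (IB L α γ ⊕ Bool) → L.Formula (α ⊕ ℤ × γ) := Sum.elim
    (fun c => c.F.relabel Sum.inr) (Sum.elim (fun c => c.F)
      (fun t => if t then φ.relabel (Sum.map id (fun q => (1, q))) else
        ∼(φ.relabel (Sum.map id (fun q => (0, q))))))
  obtain ⟨E, v, hv⟩ := compactness (U := U) (V := α ⊕ ℤ × γ) (ι := ι)
    (fun i => (G i.down).relabel Sum.inl) (by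
    intro s
    obtain ⟨a, b, h1, h2, h3, h4⟩ := hcon
      (s.preimage (fun c => ⟨Sum.inl c⟩)
        (by intro x _ y _ h; exact Sum.inl_injective (congrArg ULift.down h)))
      (s.preimage (fun c => ⟨Sum.inr (Sum.inl c)⟩) (by
        intro x _ y _ h
        exact Sum.inl_injective (Sum.inr_injective (congrArg ULift.down h))))
    refine ⟨Sum.elim a (fun p => b p.1 p.2), ?_⟩
    rintro ⟨i⟩ hi
    simp only [Formula.realize_relabel]
    rcases i with c | c | c
    · simp only [G, Sum.elim_inl, Formula.realize_relabel]
      exact h1 c (Finset.mem_preimage.2 hi)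
    · exact h2 c (Finset.mem_preimage.2 hi)
    · cases c
      · simp only [G, Sum.elim_inr, Bool.false_eq_true, if_false]
        refine fun h => h4 ?_
        have h' := Formula.realize_relabel.1 h
        convert h' using 1
        funext y; rcases y with y | y <;> rfl
      · simp only [G, Sum.elim_inr, if_true, Formula.realize_relabel]
        convert h3 using 1
        funext y; rcases y with y | y <;> rfl)
  let a := v ∘ Sum.inl
  let b : ℤ → γ → E.Carrier := fun z q => v (Sum.inr (z, q))
  have hvv : v = Sum.elim a (fun p => b p.1 p.2) := by
    funext y; rcases y with y | y <;> rfl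
  have hv' : ∀ i, (G i).Realize v := by
    intro i
    have := hv ⟨i⟩
    simpa only [Formula.realize_relabel, Sum.elim_comp_inl] using this
  have h0 := hv' (Sum.inr (Sum.inr false))
  have h1 := hv' (Sum.inr (Sum.inr true))
  simp only [G, Sum.elim_inr, Bool.false_eq_true, if_false, if_true] at h0 h1
  rw [Formula.realize_relabel] at h1
  refine h0 (Formula.realize_relabel.2 ?_)
  have := distal_incons hd φ ⟨E.Carrier, E.emb.comp j⟩ a b (fun c => ?_) (fun c => ?_) ?_
  · convert this using 1
    funext y; rcases y with y | y <;> rfl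
  · have := hv' (Sum.inl c)
    simp only [G, Sum.elim_inl, Formula.realize_relabel] at this
    exact this
  · have := hv' (Sum.inr (Sum.inl c))
    simp only [G, Sum.elim_inl, Sum.elim_inr] at this
    rw [hvv] at this
    exact this
  · convert h1 using 1
    funext y; rcases y with y | y <;> rfl

theorem def_rel {γ δ : Type*} (ψ : L.Formula γ) (f : γ → δ) :
    (Set.range j).Definable L {v : δ → U | ψ.Realize (v ∘ f)} := by
  rw [defM]
  refine ⟨ψ.relabel (Sum.inl ∘ f), ?_⟩
  ext v
  simp only [Set.mem_ofPred_eq, Formula.realize_relabel]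
  rfl

theorem Sys.Def_iInter_univ {W : Type*} (T : Sys W) {γ : Type} {ι : Type*} [Finite ι]
    {S : ι → Set (γ → W)} (h : ∀ i, T.Def (S i)) : T.Def {v | ∀ i, v ∈ S i} := by
  have := Sys.Def_iInter (T := T) (ι := Fin (Nat.card ι))
    (S := fun i => S ((Finite.equivFin ι).symm i)) (fun i => h _)
  convert this using 1
  ext v
  exact (Finite.equivFin ι).symm.forall_congr_right.symm

theorem distalFor [Nonempty U] (hsat : SatHyp j) (hd : IsDistal L M0) {α γ : Type}
    [Finite α] [Finite γ] (φ : L.Formula (α ⊕ γ)) :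
    (mkSys j hsat hd.1).DistalFor {v | φ.Realize v} := by
  classical
  set T := mkSys j hsat hd.1 with hT
  obtain ⟨sA, sB, hs⟩ := distal_finite j hd φ
  obtain ⟨n, hn1, hnA, hnB⟩ : ∃ n : ℕ, 1 ≤ n ∧
      (∀ c ∈ sA, ∀ l, (c.i l).natAbs ≤ n ∧ (c.i' l).natAbs ≤ n) ∧
      (∀ c ∈ sB, ∀ l, (c.i l).natAbs ≤ n ∧ (c.i' l).natAbs ≤ n) := by
    let f : ∀ {m : ℕ}, (Fin m → ℤ) → (Fin m → ℤ) → ℕ := fun i i' =>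
      Finset.univ.sup (fun l => (i l).natAbs + (i' l).natAbs)
    have hf : ∀ {m : ℕ} (i i' : Fin m → ℤ) l, (i l).natAbs + (i' l).natAbs ≤ f i i' :=
      fun i i' l => Finset.le_sup (f := fun l => (i l).natAbs + (i' l).natAbs) (Finset.mem_univ l)
    refine ⟨1 + sA.sup (fun c => f c.i c.i') + sB.sup (fun c => f c.i c.i'), by omega, ?_, ?_⟩
    · intro c hc l
      have h1 := Finset.le_sup (f := fun c : IA L γ => f c.i c.i') hc
      have h2 := hf c.i c.i' l
      omega
    · intro c hc l
      have h1 := Finset.le_sup (f := fun c : IB L α γ => f c.i c.i') hc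
      have h2 := hf c.i c.i' l
      omega
  let pX : ℤ → γ → γ ⊕ ((Fin n × γ) ⊕ (Fin n × γ)) :=
    pos n Sum.inl (Sum.inr ∘ Sum.inl) (Sum.inr ∘ Sum.inr)
  let pT : ℤ → γ → α ⊕ ((Fin n × γ) ⊕ (Fin n × γ)) :=
    pos n (fun q => Sum.inr (Sum.inl (⟨0, hn1⟩, q))) (Sum.inr ∘ Sum.inl) (Sum.inr ∘ Sum.inr)
  let X : Set (γ ⊕ ((Fin n × γ) ⊕ (Fin n × γ)) → U) :=
    {v | ∀ c : sA, v ∈ {v : _ → U | c.1.F.Realize (v ∘ fun p => pX p.1 p.2)}}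
  let Θ1 : Set (α ⊕ ((Fin n × γ) ⊕ (Fin n × γ)) → U) :=
    {v | ∀ c : sB, v ∈ {v : _ → U | c.1.F.Realize (v ∘ Sum.elim Sum.inl fun p => pT p.1 p.2)}}
  let Θ2 : Set (α ⊕ ((Fin n × γ) ⊕ (Fin n × γ)) → U) :=
    {v | φ.Realize (v ∘ Sum.elim Sum.inl (pT 1))}
  -- evaluation of conditions at bounded indices
  have tupcong : ∀ {m : ℕ} (b b' : ℤ → γ → U) (i : Fin m → ℤ), (∀ l, b (i l) = b' (i l)) →
      Sys.tup b i = Sys.tup b' i := by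
    intro m b b' i h
    funext p
    exact congrFun (h p.1) p.2
  refine ⟨n, Θ1 ∩ Θ2, X, ?_, ?_, ?_, ?_⟩
  · exact T.inter (T.Def_iInter_univ (fun c => def_rel j _ _)) (def_rel j _ _)
  · exact T.Def_iInter_univ (fun c => def_rel j _ _)
  · rintro x y d ⟨hΘ1, hΘ2⟩ hX
    let b : ℤ → γ → U := fun z q => Sum.elim y d (pX z q)
    let b' : ℤ → γ → U := fun z q => Sum.elim x d (pT z q)
    have hbb : ∀ z : ℤ, z ≠ 0 → z.natAbs ≤ n → b z = b' z := by
      intro z hz hzn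
      funext q
      refine (comp_pos (Sum.elim y d) n _ _ _ z q).trans ?_
      refine Eq.trans ?_ (comp_pos (Sum.elim x d) n _ _ _ z q).symm
      exact pos_congr n _ _ _ _ z hz hzn q
    have hb0 : b 0 = y := by
      funext q
      simp [b, pX, pos]
    have := hs x b (fun c hc => hX ⟨c, hc⟩) (fun c hc => by
      have h1 := hΘ1 ⟨c, hc⟩
      have h2 : (Sum.elim x d ∘ Sum.elim Sum.inl fun p : ℤ × γ => pT p.1 p.2) =
          Sum.elim x (fun p => b' p.1 p.2) := by
        funext y; rcases y with y | y <;> rfl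
      simp only [Set.mem_ofPred_eq] at h1
      rw [h2, IB.realize] at h1
      rw [IB.realize, tupcong b b' c.i (fun l => hbb _ (c.h0 l) (hnB c hc l).1),
        tupcong b b' c.i' (fun l => hbb _ (c.h0' l) (hnB c hc l).2)]
      exact h1) (by
      have h2 : (Sum.elim x d ∘ Sum.elim Sum.inl (pT 1)) = Sum.elim x (b' 1) := by
        funext y; rcases y with y | y <;> rfl
      rw [hbb 1 (by norm_num) (by simpa using hn1)]
      simp only [Θ2, Set.mem_ofPred_eq] at hΘ2
      rw [h2] at hΘ2
      exact hΘ2)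
    rw [hb0] at this
    exact this
  · intro g a hg hφ
    let b : ℤ → γ → U := fun z q => Sum.elim (g n) (Sys.dd n g) (pX z q)
    let b' : ℤ → γ → U := fun z q => Sum.elim a (Sys.dd n g) (pT z q)
    have hb : ∀ z : ℤ, z.natAbs ≤ n → b z = g (z + n).toNat := by
      intro z hz
      funext q
      refine (comp_pos (Sum.elim (g n) (Sys.dd n g)) n _ _ _ z q).trans ?_
      exact pos_dd n g _ z hz (fun _ => rfl) q
    have hb' : ∀ z : ℤ, z ≠ 0 → z.natAbs ≤ n → b' z = g (z + n).toNat := by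
      intro z hz0 hz
      funext q
      refine (comp_pos (Sum.elim a (Sys.dd n g)) n _ _ _ z q).trans ?_
      exact pos_dd n g _ z hz (fun h => absurd h hz0) q
    have hmono : ∀ {m : ℕ} (i : Fin m → ℤ), StrictMono i → (∀ l, (i l).natAbs ≤ n) →
        StrictMono (fun l => (i l + n).toNat) ∧ ∀ l, (i l + n).toNat < 2 * n + 1 := by
      intro m i hi hl
      refine ⟨fun x y h => ?_, fun l => ?_⟩
      · have h1 := hi h
        have h2 := hl x
        have h3 := hl y
        simp only
        omega
      · have := hl l
        omega
    refine ⟨⟨fun c => ?_, ?_⟩, fun c => ?_⟩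
    · obtain ⟨c, hc⟩ := c
      have h2 : (Sum.elim a (Sys.dd n g) ∘ Sum.elim Sum.inl fun p : ℤ × γ => pT p.1 p.2) =
          Sum.elim a (fun p => b' p.1 p.2) := by
        funext y; rcases y with y | y <;> rfl
      simp only [Set.mem_ofPred_eq]
      rw [h2, IB.realize]
      have e1 : Sys.tup b' c.i = Sys.tup g (fun l => (c.i l + n).toNat) := by
        funext p; exact congrFun (hb' _ (c.h0 p.1) (hnB c hc p.1).1) p.2
      have e2 : Sys.tup b' c.i' = Sys.tup g (fun l => (c.i' l + n).toNat) := by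
        funext p; exact congrFun (hb' _ (c.h0' p.1) (hnB c hc p.1).2) p.2
      rw [e1, e2]
      have m1 := hmono c.i c.hi (fun l => (hnB c hc l).1)
      have m2 := hmono c.i' c.hi' (fun l => (hnB c hc l).2)
      exact hg c.m _ _ m1.1 m2.1 m1.2 m2.2 _ (def_rel j c.δ id)
    · have h2 : (Sum.elim a (Sys.dd n g) ∘ Sum.elim Sum.inl (pT 1)) = Sum.elim a (b' 1) := by
        funext y; rcases y with y | y <;> rfl
      simp only [Θ2, Set.mem_ofPred_eq]
      rw [h2, hb' 1 (by norm_num) (by simpa using hn1)]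
      exact hφ _ (by omega)
    · obtain ⟨c, hc⟩ := c
      show c.F.Realize (fun p => b p.1 p.2)
      rw [IA.realize]
      have e1 : Sys.tup b c.i = Sys.tup g (fun l => (c.i l + n).toNat) := by
        funext p; exact congrFun (hb _ (hnA c hc p.1).1) p.2
      have e2 : Sys.tup b c.i' = Sys.tup g (fun l => (c.i' l + n).toNat) := by
        funext p; exact congrFun (hb _ (hnA c hc p.1).2) p.2
      rw [e1, e2]
      have m1 := hmono c.i c.hi (fun l => (hnA c hc l).1)
      have m2 := hmono c.i' c.hi' (fun l => (hnA c hc l).2)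
      exact hg c.m _ _ m1.1 m2.1 m1.2 m2.2 _ (def_rel j c.δ Sum.inr)

end ModelTheory
end

section
section ModelTheory
variable {L : FirstOrder.Language.{u, v}}

theorem main_empty {N : Type w} [L.Structure N] [IsEmpty N]
    (M : L.ElementarySubstructure N)
    (nx ny np : ℕ) (φ : L.Formula (Fin nx ⊕ (Fin ny ⊕ Fin np))) (mp : Fin np → M)
    (b : Fin ny → N)
    (hndiv : ¬ Divides L (M : Set N) φ (Sum.elim b fun i => ((mp i : N)))) :
    ∃ (np' : ℕ) (ψ : L.Formula (Fin ny ⊕ Fin np')) (mp' : Fin np' → M),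
      ψ.Realize (Sum.elim b fun i => ((mp' i : N))) ∧
      ∀ (k : ℕ) (bs : Fin k → Fin ny → M),
        (∀ i, ψ.Realize (Sum.elim (bs i) mp')) →
        ∃ a : Fin nx → N, ∀ i,
          φ.Realize (Sum.elim a (Sum.elim (fun l => ((bs i l : N))) fun l => ((mp l : N)))) := by
  let e : N ≃ ULift.{max u v} N := Equiv.ulift.symm
  let _ : L.Structure (ULift.{max u v} N) := e.inducedStructure
  let em : N ↪ₑ[L] ULift.{max u v} N := (e.inducedStructureEquiv (L := L)).toElementaryEmbedding
  have hcons : IsConsistentFamily L φ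
      (fun _ : ℕ => (em ∘ Sum.elim b fun i => ((mp i : N)))) := by
    by_contra hc
    refine hndiv ⟨⟨ULift.{max u v} N, em⟩, fun _ => em ∘ Sum.elim b fun i => ((mp i : N)), ?_, ?_, hc⟩
    · intro m i i' _ _ p θ mm _
      exact Iff.rfl
    · intro p θ mm _
      exact Iff.rfl
  obtain ⟨a, ha⟩ := hcons {0}
  obtain ⟨a, ha⟩ := (ex_transfer em {0} (fun _ : ℕ => φ) _).1 ⟨a, ha⟩
  refine ⟨0, ⊤, Fin.elim0, by simp, fun k bs _ => ⟨a, fun i => ?_⟩⟩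
  have h1 := ha 0 (by simp)
  convert h1 using 1

theorem main_nonempty {N : Type w} [L.Structure N] [Nonempty N]
    (M : L.ElementarySubstructure N) (hdistal : IsDistal L M)
    (nx ny np : ℕ) (φ : L.Formula (Fin nx ⊕ (Fin ny ⊕ Fin np))) (mp : Fin np → M)
    (b : Fin ny → N)
    (hndiv : ¬ Divides L (M : Set N) φ (Sum.elim b fun i => ((mp i : N)))) :
    ∃ (np' : ℕ) (ψ : L.Formula (Fin ny ⊕ Fin np')) (mp' : Fin np' → M),
      ψ.Realize (Sum.elim b fun i => ((mp' i : N))) ∧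
      ∀ (k : ℕ) (bs : Fin k → Fin ny → M),
        (∀ i, ψ.Realize (Sum.elim (bs i) mp')) →
        ∃ a : Fin nx → N, ∀ i,
          φ.Realize (Sum.elim a (Sum.elim (fun l => ((bs i l : N))) fun l => ((mp l : N)))) := by
  classical
  obtain ⟨E, hE⟩ := exists_saturated (L := L) N
  have : Nonempty E.Carrier := ‹Nonempty N›.map E.emb
  let j : M ↪ₑ[L] E.Carrier := E.emb.comp M.subtype
  have hsat : SatHyp j := by
    intro k B _ h p hp
    have hr : ∀ (θ : L.Formula (Fin k ⊕ (B ⊕ M))) (v : Fin k → E.Carrier),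
        (θ.relabel (Sum.map id (Sum.map id (fun x : M => (x : N)))) :
          L.Formula (Fin k ⊕ (B ⊕ N))).Realize (Sum.elim v (Sum.elim h E.emb)) ↔
        θ.Realize (Sum.elim v (Sum.elim h j)) := by
      intro θ v
      rw [Formula.realize_relabel]
      apply iff_of_eq; congr 1
      funext y; rcases y with y | y | y <;> rfl
    obtain ⟨v, hv⟩ := hE k B h ((fun θ => Formula.relabel
        (Sum.map id (Sum.map id (fun x : M => (x : N)))) θ) '' p) (by
      intro t ht
      choose! g hg using ht
      obtain ⟨v, hv⟩ := hp (t.image g) (by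
        intro θ hθ
        obtain ⟨x, hx, rfl⟩ := Finset.mem_image.1 hθ
        exact (hg x hx).1)
      refine ⟨v, fun θ hθ => ?_⟩
      rw [← (hg θ hθ).2]
      exact (hr _ v).2 (hv _ (Finset.mem_image_of_mem g hθ)))
    exact ⟨v, fun θ hθ => (hr θ v).1 (hv _ ⟨θ, hθ, rfl⟩)⟩
  set T := mkSys j hsat hdistal.1 with hT
  let bN : Fin ny ⊕ Fin np → N := Sum.elim b fun i => ((mp i : N))
  have hty : ∀ {γ : Type} (c c' : γ → E.Carrier), T.eqv c c' →
      SameTypeOver L (E.emb '' (M : Set N)) c c' := by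
    intro γ c c' h p θ m hm
    have : ∀ i, ∃ x : M, j x = m i := fun i => by
      obtain ⟨x, hx, hx'⟩ := hm i
      exact ⟨⟨x, hx⟩, hx'⟩
    choose m' hm' using this
    obtain rfl : j ∘ m' = m := funext hm'
    exact h _ (def_of j θ m')
  have hND : T.ND {v | φ.Realize v} (E.emb ∘ bN) := by
    intro b' hb' h0 n
    by_contra hcon
    refine hndiv ⟨E, b', ?_, ?_, ?_⟩
    · intro m i i' hi hi'
      exact hty _ _ (hb' m i i' hi hi')
    · exact hty _ _ (fun S hS => (h0 S hS).symm)
    · intro hc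
      obtain ⟨a, ha⟩ := hc (Finset.range n)
      exact hcon ⟨a, fun l hl => ha l (Finset.mem_range.2 hl)⟩
  have hφ : T.Def {v : Fin nx ⊕ (Fin ny ⊕ Fin np) → E.Carrier | φ.Realize v} := def_rel j φ id
  obtain ⟨Ψ, hΨ, hbΨ, hmain⟩ := Sys.abstract_main hφ hND (distalFor j hsat hdistal φ)
  obtain ⟨n0, ψ0, m, rfl⟩ := finrep j hΨ
  let ψ : L.Formula (Fin ny ⊕ Fin (np + n0)) := ψ0.relabel
    (Sum.elim (Sum.elim Sum.inl (Sum.inr ∘ Fin.castAdd n0)) (Sum.inr ∘ Fin.natAdd np))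
  have hψ : ∀ {K : Type (max u v w)} [L.Structure K] (f : M → K) (y : Fin ny → K),
      ψ.Realize (Sum.elim y (f ∘ Fin.append mp m)) ↔
      ψ0.Realize (Sum.elim (Sum.elim y (f ∘ mp)) (f ∘ m)) := by
    intro K _ f y
    simp only [ψ, Formula.realize_relabel]
    apply iff_of_eq; congr 1
    funext y; rcases y with (y | y) | y <;> simp
  refine ⟨np + n0, ψ, Fin.append mp m, ?_, ?_⟩
  · rw [← E.emb.map_formula]
    have h1 : (E.emb ∘ Sum.elim b fun i => ((Fin.append mp m i : M) : N)) =
        Sum.elim (E.emb ∘ b) (j ∘ Fin.append mp m) := by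
      funext y; rcases y with y | y <;> rfl
    rw [h1, hψ]
    have h2 : Sum.elim (E.emb ∘ b) (j ∘ mp) = E.emb ∘ bN := by
      funext y; rcases y with y | y <;> rfl
    rw [h2]
    exact hbΨ
  · intro k bs hbs
    obtain ⟨x, hx⟩ := hmain k (fun i => Sum.elim (j ∘ bs i) (j ∘ mp)) (by
      intro i
      have h1 := (j.map_formula ψ _).2 (hbs i)
      rw [Sum.comp_elim, hψ] at h1
      exact h1)
    let c : Fin k × (Fin ny ⊕ Fin np) → N := fun p =>
      Sum.elim (fun l => ((bs p.1 l : N))) (fun l => ((mp l : N))) p.2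
    let F : Fin k → L.Formula (Fin nx ⊕ (Fin k × (Fin ny ⊕ Fin np))) := fun i =>
      φ.relabel (Sum.map id (fun q => (i, q)))
    obtain ⟨a, ha⟩ := (ex_transfer E.emb Finset.univ F c).1 ⟨x, fun i _ => by
      simp only [F, Formula.realize_relabel]
      have h1 : φ.Realize _ := hx i
      convert h1 using 1
      funext y; rcases y with y | y | y <;> rfl⟩
    refine ⟨a, fun i => ?_⟩
    have h1 := ha i (Finset.mem_univ i)
    simp only [F, Formula.realize_relabel] at h1
    convert h1 using 1
    funext y; rcases y with y | y | y <;> rfl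

end ModelTheory
end

/-- Theorem 1.2 of the paper. Let `M ⪯ N` with `M` distal (in particular
NIP). Let `φ(x, y)` be an `L`-formula with parameters `mp` from `M` and let `b` be a tuple
from `N`. If `φ(x, b)` does not divide over `M`, then there is an `L`-formula `ψ(y)` with
parameters `mp'` from `M`, satisfied by `b` in `N`, such that the family
`{φ(x, b') : b'` a tuple from `M` with `M ⊨ ψ(b')}` is consistent (finitely satisfiable). -/
theorem statement0 {L : FirstOrder.Language.{u, v}} {N : Type w} [L.Structure N]
    (M : L.ElementarySubstructure N) (hdistal : IsDistal L M)
    (nx ny np : ℕ) (φ : L.Formula (Fin nx ⊕ (Fin ny ⊕ Fin np))) (mp : Fin np → M)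
    (b : Fin ny → N)
    (hndiv : ¬ Divides L (M : Set N) φ (Sum.elim b fun i => ((mp i : N)))) :
    ∃ (np' : ℕ) (ψ : L.Formula (Fin ny ⊕ Fin np')) (mp' : Fin np' → M),
      ψ.Realize (Sum.elim b fun i => ((mp' i : N))) ∧
      ∀ (k : ℕ) (bs : Fin k → Fin ny → M),
        (∀ i, ψ.Realize (Sum.elim (bs i) mp')) →
        ∃ a : Fin nx → N, ∀ i,
          φ.Realize (Sum.elim a (Sum.elim (fun l => ((bs i l : N))) fun l => ((mp l : N)))) := by
  rcases isEmpty_or_nonempty N with h | h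
  · exact main_empty M nx ny np φ mp b hndiv
  · exact main_nonempty M hdistal nx ny np φ mp b hndiv

end DistalPaper
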